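/- arXiv:2305.11883 — 3 statements merged into one kernel-verified Lean document; each statement's English description precedes it below -/
import Mathlib

section
/- Let 0<ρ<1, let μ∈ℂ, and let β be a fixed real number with πρ/2 < β < πρ. Then there exist constants C>0 and R≥1 such that for every z∈ℂ with |z|≥R and β ≤ |arg z| ≤ π one has |E_{ρ,μ}(z) + z^{−1}/Γ(μ−ρ)| ≤ C|z|^{−2}. -/
/-- The two-parameter Mittag-Leffler function. -/
noncomputable def mlE (ρ : ℝ) (μ : ℂ) (z : ℂ) : ℂ :=
  ∑' k : ℕ, z ^ k / Complex.Gamma (((ρ * k : ℝ) : ℂ) + μ)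

open Complex Set Filter Topology MeasureTheory

/-- The integrand `exp (e ^ w + (1 - s) w)` of Hankel's formula for `1 / Γ(s)`, written in the
logarithmic variable `w = log t`. -/
noncomputable def hankelKernel (s w : ℂ) : ℂ := exp (exp w + (1 - s) * w)

/-- The integral of `f` along the contour that comes in from `+∞` on the line `Im w = -θ`, climbs
the segment `Re w = a` and goes back to `+∞` on the line `Im w = θ`. -/
noncomputable def hankelIntegral (θ a : ℝ) (f : ℂ → ℂ) : ℂ :=
  (∫ x : ℝ in Ioi a, f (x + θ * I)) - (∫ x : ℝ in Ioi a, f (x + (-θ : ℝ) * I)) +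
    I * ∫ y : ℝ in (-θ)..θ, f (a + y * I)

/-- All three pieces of `hankelIntegral θ a f` are integrals of integrable functions. -/
structure HankelIntegrable (θ a : ℝ) (f : ℂ → ℂ) : Prop where
  upper : IntegrableOn (fun x : ℝ => f (x + θ * I)) (Ioi a)
  lower : IntegrableOn (fun x : ℝ => f (x + (-θ : ℝ) * I)) (Ioi a)
  segment : IntervalIntegrable (fun y : ℝ => f (a + y * I)) volume (-θ) θ

theorem differentiable_hankelKernel (s : ℂ) : Differentiable ℂ (hankelKernel s) := by
  unfold hankelKernel
  fun_prop

theorem continuous_hankelKernel (s : ℂ) : Continuous (hankelKernel s) :=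
  (differentiable_hankelKernel s).continuous

theorem norm_hankelKernel (s : ℂ) (x y : ℝ) :
    ‖hankelKernel s (x + y * I)‖ =
      Real.exp (Real.exp x * Real.cos y + (1 - s.re) * x + s.im * y) := by
  rw [hankelKernel, norm_exp]
  congr 1
  simp [exp_re]
  ring

theorem exp_mul_hankelKernel (s r w : ℂ) :
    exp (r * w) * hankelKernel s w = hankelKernel (s - r) w := by
  rw [hankelKernel, hankelKernel, ← Complex.exp_add]
  ring_nf

theorem exists_exp_neg_mul_exp_add_le {c : ℝ} (hc : 0 < c) (M : ℝ) :
    ∃ K : ℝ, ∀ x : ℝ, 0 ≤ x → Real.exp (-c * Real.exp x + M * x) ≤ K * Real.exp (-1 * x) := by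
  refine ⟨Real.exp ((M + 1) ^ 2 / (2 * c)), fun x hx => ?_⟩
  rw [← Real.exp_add, Real.exp_le_exp]
  have h1 : x ^ 2 / 2 ≤ Real.exp x := by
    have := Real.quadratic_le_exp_of_nonneg hx
    linarith
  have h2 : c * (x ^ 2 / 2) ≤ c * Real.exp x := by gcongr
  have h3 : (M + 1) * x - c * (x ^ 2 / 2) ≤ (M + 1) ^ 2 / (2 * c) := by
    rw [le_div_iff₀ (by positivity)]
    nlinarith [sq_nonneg (M + 1 - c * x)]
  linarith

theorem isBigO_exp_neg_mul_exp_add {c : ℝ} (hc : 0 < c) (M : ℝ) :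
    (fun x : ℝ => Real.exp (-c * Real.exp x + M * x)) =O[atTop] fun x => Real.exp (-1 * x) := by
  obtain ⟨K, hK⟩ := exists_exp_neg_mul_exp_add_le hc M
  refine Asymptotics.IsBigO.of_bound K ?_
  filter_upwards [eventually_ge_atTop 0] with x hx
  simpa only [Real.norm_eq_abs, Real.abs_exp] using hK x hx

theorem tendsto_exp_neg_mul_exp_add {c : ℝ} (hc : 0 < c) (M : ℝ) :
    Tendsto (fun x : ℝ => Real.exp (-c * Real.exp x + M * x)) atTop (𝓝 0) := by
  refine (isBigO_exp_neg_mul_exp_add hc M).trans_tendsto ?_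
  simpa using Real.tendsto_exp_neg_atTop_nhds_zero

theorem integrableOn_hankelKernel_ray (s : ℂ) (a : ℝ) {y : ℝ} (hy : Real.cos y < 0) :
    IntegrableOn (fun x : ℝ => hankelKernel s (x + y * I)) (Ioi a) := by
  have hc : Continuous fun x : ℝ => hankelKernel s (x + y * I) :=
    (continuous_hankelKernel s).comp (by fun_prop)
  have h : IntegrableOn (fun x : ℝ => Real.exp (s.im * y) *
      Real.exp (-(-Real.cos y) * Real.exp x + (1 - s.re) * x)) (Ioi a) :=
    (integrable_of_isBigO_exp_neg one_pos (by fun_prop)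
      (isBigO_exp_neg_mul_exp_add (neg_pos.2 hy) (1 - s.re))).const_mul _
  refine Integrable.mono' h hc.aestronglyMeasurable (ae_of_all _ fun x => ?_)
  rw [norm_hankelKernel, ← Real.exp_add, Real.exp_le_exp]
  linarith

theorem hankelIntegrable_of_norm_le {θ a K : ℝ} {s : ℂ} {f : ℂ → ℂ} (hθ0 : 0 ≤ θ)
    (hθ : Real.cos θ < 0) (hf : ∀ w : ℂ, |w.im| ≤ θ → DifferentiableAt ℂ f w)
    (hle : ∀ w : ℂ, |w.im| ≤ θ → ‖f w‖ ≤ K * ‖hankelKernel s w‖) :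
    HankelIntegrable θ a f := by
  have hray : ∀ y : ℝ, |y| ≤ θ → Real.cos y < 0 →
      IntegrableOn (fun x : ℝ => f (x + y * I)) (Ioi a) := fun y hy hcos => by
    refine Integrable.mono' ((integrableOn_hankelKernel_ray s a hcos).norm.const_mul K) ?_
      (ae_of_all _ fun x => hle _ (by simpa using hy))
    refine Continuous.aestronglyMeasurable (continuous_iff_continuousAt.2 fun x => ?_)
    exact ContinuousAt.comp (f := fun x : ℝ => (x + y * I : ℂ))
      (hf _ (by simpa using hy)).continuousAt (by fun_prop)
  refine ⟨hray θ (abs_of_nonneg hθ0).le hθ, hray (-θ) (by simp [abs_of_nonneg hθ0]) (by simpa), ?_⟩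
  refine ContinuousOn.intervalIntegrable fun y hy => ContinuousAt.continuousWithinAt ?_
  rw [uIcc_of_le (by linarith)] at hy
  exact ContinuousAt.comp (f := fun y : ℝ => (a + y * I : ℂ))
    (hf _ (by simpa using abs_le.2 hy)).continuousAt (by fun_prop)

theorem hankelIntegrable_hankelKernel (s : ℂ) {θ : ℝ} (a : ℝ) (hθ0 : 0 ≤ θ)
    (hθ : Real.cos θ < 0) : HankelIntegrable θ a (hankelKernel s) :=
  hankelIntegrable_of_norm_le (K := 1) (s := s) hθ0 hθ
    (fun w _ => differentiable_hankelKernel s w) fun w _ => by simp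

/-- The Hankel integral of a function holomorphic in the strip does not depend on the abscissa of
the vertical segment. -/
theorem hankelIntegral_eq_of_le {θ a b : ℝ} {f : ℂ → ℂ} (hθ0 : 0 ≤ θ) (hab : a ≤ b)
    (hf : ∀ w : ℂ, |w.im| ≤ θ → DifferentiableAt ℂ f w) (ha : HankelIntegrable θ a f) :
    hankelIntegral θ a f = hankelIntegral θ b f := by
  have hrect := integral_boundary_rect_eq_zero_of_differentiableOn f ⟨a, -θ⟩ ⟨b, θ⟩
    fun w hw => (hf w (abs_le.2 (by
      have := hw.2
      rwa [uIcc_of_le (show -θ ≤ θ by linarith)] at this))).differentiableWithinAt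
  have hu := intervalIntegral.integral_Ioi_sub_Ioi ha.upper hab
  have hl := intervalIntegral.integral_Ioi_sub_Ioi ha.lower hab
  simp only [smul_eq_mul] at hrect
  unfold hankelIntegral
  linear_combination hu - hl - hrect

/-- The horizontal rays of the contour may be rotated as long as the kernel decays along them. -/
theorem integral_ray_sub_integral_ray_hankelKernel (s : ℂ) (a : ℝ) {y₁ y₂ c : ℝ} (hc : 0 < c)
    (hy : y₁ ≤ y₂) (hcos : ∀ y ∈ Icc y₁ y₂, Real.cos y ≤ -c) :
    (∫ x : ℝ in Ioi a, hankelKernel s (x + y₁ * I)) -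
      (∫ x : ℝ in Ioi a, hankelKernel s (x + y₂ * I)) =
        I * ∫ y : ℝ in y₁..y₂, hankelKernel s (a + y * I) := by
  have h1 := integrableOn_hankelKernel_ray s a
    ((hcos y₁ (left_mem_Icc.2 hy)).trans_lt (neg_lt_zero.2 hc))
  have h2 := integrableOn_hankelKernel_ray s a
    ((hcos y₂ (right_mem_Icc.2 hy)).trans_lt (neg_lt_zero.2 hc))
  have hrect : ∀ T : ℝ, (∫ x : ℝ in a..T, hankelKernel s (x + y₁ * I)) -
      (∫ x : ℝ in a..T, hankelKernel s (x + y₂ * I)) +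
      I * (∫ y : ℝ in y₁..y₂, hankelKernel s (T + y * I)) =
      I * ∫ y : ℝ in y₁..y₂, hankelKernel s (a + y * I) := fun T => by
    have := integral_boundary_rect_eq_zero_of_differentiableOn (hankelKernel s) ⟨a, y₁⟩ ⟨T, y₂⟩
      (differentiable_hankelKernel s).differentiableOn
    simp only [smul_eq_mul] at this
    linear_combination this
  have hside : Tendsto (fun T : ℝ => ∫ y : ℝ in y₁..y₂, hankelKernel s (T + y * I)) atTop
      (𝓝 0) := by
    set B := |s.im| * (|y₁| + |y₂|) with hB
    have hlim := ((tendsto_exp_neg_mul_exp_add hc (1 - s.re)).const_mul (Real.exp B)).mul_const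
      |y₂ - y₁|
    rw [mul_zero, zero_mul] at hlim
    refine squeeze_zero_norm (fun T => ?_) hlim
    refine intervalIntegral.norm_integral_le_of_norm_le_const fun y hy' => ?_
    rw [uIoc_of_le hy] at hy'
    rw [norm_hankelKernel, ← Real.exp_add, Real.exp_le_exp]
    have h3 := hcos y (Ioc_subset_Icc_self hy')
    have h4 : Real.exp T * Real.cos y ≤ Real.exp T * -c := by gcongr
    have h5 : s.im * y ≤ B := by
      refine (le_abs_self _).trans ?_
      rw [abs_mul, hB]
      gcongr
      exact (abs_le_max_abs_abs hy'.1.le hy'.2).trans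
        (max_le_add_of_nonneg (abs_nonneg _) (abs_nonneg _))
    linarith
  have hlim := ((intervalIntegral_tendsto_integral_Ioi a h1 tendsto_id).sub
    (intervalIntegral_tendsto_integral_Ioi a h2 tendsto_id)).add (hside.const_mul I)
  simp only [id, hrect, mul_zero, add_zero] at hlim
  exact tendsto_nhds_unique hlim tendsto_const_nhds

theorem hankelIntegral_hankelKernel_eq_pi (s : ℂ) (a : ℝ) {θ : ℝ} (hθ : Real.pi / 2 < θ)
    (hθπ : θ ≤ Real.pi) :
    hankelIntegral θ a (hankelKernel s) = hankelIntegral Real.pi a (hankelKernel s) := by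
  have hpi := Real.pi_pos
  have hc : 0 < -Real.cos θ :=
    neg_pos.2 (Real.cos_neg_of_pi_div_two_lt_of_lt hθ (by linarith))
  have hcos : ∀ y ∈ Icc θ Real.pi, Real.cos y ≤ - -Real.cos θ := fun y hy => by
    rw [neg_neg]
    exact Real.cos_le_cos_of_nonneg_of_le_pi (by linarith) hy.2 hy.1
  have hu := integral_ray_sub_integral_ray_hankelKernel s a hc hθπ hcos
  have hl := integral_ray_sub_integral_ray_hankelKernel s a hc (neg_le_neg hθπ) fun y hy => by
    rw [← Real.cos_neg y]
    exact hcos (-y) ⟨by linarith [hy.2], by linarith [hy.1]⟩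
  have hintg : ∀ b d : ℝ, IntervalIntegrable (fun y : ℝ => hankelKernel s (a + y * I)) volume b d :=
    fun b d => ((continuous_hankelKernel s).comp (by fun_prop)).intervalIntegrable b d
  have h1 := intervalIntegral.integral_add_adjacent_intervals (hintg (-Real.pi) (-θ)) (hintg (-θ) θ)
  have h2 := intervalIntegral.integral_add_adjacent_intervals (hintg (-Real.pi) θ)
    (hintg θ Real.pi)
  unfold hankelIntegral
  linear_combination hu + hl + I * h1 + I * h2

theorem hankelIntegral_hankelKernel_abscissa (s : ℂ) {θ : ℝ} (a b : ℝ) (hθ0 : 0 ≤ θ)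
    (hθ : Real.cos θ < 0) :
    hankelIntegral θ a (hankelKernel s) = hankelIntegral θ b (hankelKernel s) := by
  wlog hab : a ≤ b
  · exact (this s b a hθ0 hθ (le_of_not_ge hab)).symm
  exact hankelIntegral_eq_of_le hθ0 hab (fun w _ => differentiable_hankelKernel s w)
    (hankelIntegrable_hankelKernel s a hθ0 hθ)

theorem hankelKernel_of_exp_eq_neg_one (s : ℂ) (x : ℝ) {y : ℝ} (hy : exp (y * I) = -1) :
    hankelKernel s (x + y * I) =
      exp ((1 - s) * (y * I)) *
        (|Real.exp x| • ((Real.exp (-Real.exp x) : ℂ) * (Real.exp x : ℂ) ^ (1 - s - 1))) := by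
  have hx : (Real.exp x : ℂ) ≠ 0 := by exact_mod_cast (Real.exp_pos x).ne'
  rw [Real.abs_exp, real_smul, cpow_def_of_ne_zero hx, ← ofReal_log (Real.exp_pos x).le,
    Real.log_exp, hankelKernel, Complex.exp_add (x : ℂ), hy]
  push_cast
  simp only [← Complex.exp_add]
  ring_nf

theorem integral_hankelKernel_ray_of_exp_eq_neg_one (s : ℂ) (a : ℝ) {y : ℝ}
    (hy : exp (y * I) = -1) :
    ∫ x : ℝ in Ioi a, hankelKernel s (x + y * I) = exp ((1 - s) * (y * I)) *
      ∫ t : ℝ in Ioi (Real.exp a), (Real.exp (-t) : ℂ) * (t : ℂ) ^ (1 - s - 1) := by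
  have himage : Real.exp '' Ioi a = Ioi (Real.exp a) := by
    ext t
    constructor
    · rintro ⟨x, hx, rfl⟩
      exact Real.exp_lt_exp.2 hx
    · intro ht
      have ht0 : 0 < t := (Real.exp_pos a).trans ht
      exact ⟨Real.log t, (Real.lt_log_iff_exp_lt ht0).2 ht, Real.exp_log ht0⟩
  rw [← himage, integral_image_eq_integral_abs_deriv_smul measurableSet_Ioi
    (fun x _ => (Real.hasDerivAt_exp x).hasDerivWithinAt) Real.exp_injective.injOn,
    ← integral_const_mul]
  simp only [hankelKernel_of_exp_eq_neg_one s _ hy]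

theorem tendsto_integral_hankelKernel_ray {s : ℂ} (hs : s.re < 1) {y : ℝ}
    (hy : exp (y * I) = -1) :
    Tendsto (fun a : ℝ => ∫ x : ℝ in Ioi a, hankelKernel s (x + y * I)) atBot
      (𝓝 (exp ((1 - s) * (y * I)) * Gamma (1 - s))) := by
  have hs' : 0 < (1 - s).re := by simpa using hs
  simp only [integral_hankelKernel_ray_of_exp_eq_neg_one s _ hy]
  refine Tendsto.const_mul _ ?_
  rw [Gamma_eq_integral hs', GammaIntegral]
  have h := (aecover_Ioi_of_Ioi (μ := volume) Real.tendsto_exp_atBot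
    ).integral_tendsto_of_countably_generated (GammaIntegral_convergent hs')
  refine h.congr fun a => ?_
  rw [Measure.restrict_restrict measurableSet_Ioi, Ioi_inter_Ioi,
    sup_of_le_left (Real.exp_pos a).le]

theorem tendsto_integral_hankelKernel_segment {s : ℂ} (hs : s.re < 1) (θ : ℝ) :
    Tendsto (fun a : ℝ => ∫ y : ℝ in (-θ)..θ, hankelKernel s (a + y * I)) atBot (𝓝 0) := by
  set B := 1 + |s.im| * |θ| with hB
  have hexp : Tendsto (fun a : ℝ => Real.exp ((1 - s.re) * a)) atBot (𝓝 0) :=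
    Real.tendsto_exp_atBot.comp (tendsto_id.const_mul_atBot (sub_pos.2 hs))
  have hlim := (hexp.const_mul (Real.exp B)).mul_const |θ - -θ|
  rw [mul_zero, zero_mul] at hlim
  refine squeeze_zero_norm' ?_ hlim
  filter_upwards [eventually_le_atBot 0] with a ha
  refine intervalIntegral.norm_integral_le_of_norm_le_const fun y hy => ?_
  rw [norm_hankelKernel, ← Real.exp_add, Real.exp_le_exp]
  have h1 : Real.exp a * Real.cos y ≤ 1 :=
    (mul_le_of_le_one_right (Real.exp_pos a).le (Real.cos_le_one y)).trans
      (Real.exp_le_one_iff.2 ha)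
  have h2 : s.im * y ≤ |s.im| * |θ| := by
    refine (le_abs_self _).trans ?_
    rw [abs_mul]
    refine mul_le_mul_of_nonneg_left ?_ (abs_nonneg _)
    have := abs_le_max_abs_abs (uIoc_subset_uIcc hy).1 (uIoc_subset_uIcc hy).2
    refine this.trans (max_le ?_ ?_) <;> grind
  linarith

theorem hankelIntegral_pi_of_re_lt_one {s : ℂ} (hs : s.re < 1) (a : ℝ) :
    hankelIntegral Real.pi a (hankelKernel s) = 2 * Real.pi * I * (Gamma s)⁻¹ := by
  have hpi : exp ((-Real.pi : ℝ) * I) = -1 := by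
    rw [ofReal_neg, neg_mul, Complex.exp_neg, exp_pi_mul_I]
    norm_num
  have hlim := ((tendsto_integral_hankelKernel_ray hs exp_pi_mul_I).sub
    (tendsto_integral_hankelKernel_ray hs hpi)).add
      ((tendsto_integral_hankelKernel_segment hs Real.pi).const_mul I)
  have hconst : ∀ b, hankelIntegral Real.pi b (hankelKernel s) =
      hankelIntegral Real.pi a (hankelKernel s) := fun b =>
    hankelIntegral_hankelKernel_abscissa s b a Real.pi_pos.le (by simp)
  have heq := tendsto_nhds_unique (tendsto_const_nhds.congr fun b => (hconst b).symm) hlim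
  rw [heq]
  have hsin : exp ((1 - s) * (Real.pi * I)) - exp ((1 - s) * ((-Real.pi : ℝ) * I)) =
      2 * I * sin (Real.pi * s) := by
    have h1 : sin (Real.pi * s) = sin (Real.pi * (1 - s)) := by
      rw [mul_sub, mul_one, Complex.sin_pi_sub]
    rw [h1, Complex.sin]
    push_cast
    ring_nf
    simp only [I_sq]
    ring_nf
  have hΓ : Gamma (1 - s) ≠ 0 := Gamma_ne_zero_of_re_pos (by simpa using hs)
  have hrefl : sin (Real.pi * s) * Gamma (1 - s) = Real.pi * (Gamma s)⁻¹ := by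
    have h := Gamma_mul_Gamma_one_sub s
    have hpi0 : (Real.pi : ℂ) ≠ 0 := ofReal_ne_zero.2 Real.pi_ne_zero
    have h' : Gamma s = Real.pi / sin (Real.pi * s) / Gamma (1 - s) := by
      rw [← h, mul_div_cancel_right₀ _ hΓ]
    rw [h', inv_div, div_div_eq_mul_div]
    field_simp
  linear_combination Gamma (1 - s) * hsin + 2 * I * hrefl

theorem hankelIntegral_pi_one :
    hankelIntegral Real.pi 0 (hankelKernel 1) = 2 * Real.pi * I := by
  have hpi : exp ((-Real.pi : ℝ) * I) = exp (Real.pi * I) := by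
    rw [ofReal_neg, neg_mul, Complex.exp_neg, exp_pi_mul_I]
    norm_num
  have hker : ∀ w, hankelKernel 1 w = exp (exp w) := fun w => by simp [hankelKernel]
  have hseg : ∫ y : ℝ in (-Real.pi)..Real.pi, exp (exp (y * I)) = 2 * Real.pi := by
    have h := (differentiable_exp.diffContOnCl (s := Metric.ball 0 |1|)).circleAverage
    rw [Real.circleAverage_eq_integral_add (-Real.pi)] at h
    rw [intervalIntegral.integral_comp_add_right fun y => exp (circleMap 0 1 y), inv_smul_eq_iff₀
      (by positivity), zero_add, show 2 * Real.pi + -Real.pi = Real.pi by ring] at h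
    simpa [circleMap] using h
  simp only [hankelIntegral, hker, Complex.exp_add, hpi, sub_self, zero_add, ofReal_zero, hseg]
  ring

theorem hankelIntegral_pi_eq_mul_add_one (s : ℂ) :
    hankelIntegral Real.pi 0 (hankelKernel s) =
      s * hankelIntegral Real.pi 0 (hankelKernel (s + 1)) := by
  set g : ℂ → ℂ := hankelKernel (s + 1)
  have hg : ∀ w, HasDerivAt g (hankelKernel s w - s * g w) w := fun w => by
    have h := (((Complex.hasDerivAt_exp w).add ((hasDerivAt_id w).const_mul (1 - (s + 1))))).cexp
    refine h.congr_deriv ?_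
    simp only [g, hankelKernel, id, Pi.add_apply]
    rw [mul_add, ← Complex.exp_add]
    ring_nf
  have hray : ∀ y : ℝ, Real.cos y < 0 → (∫ x : ℝ in Ioi (0 : ℝ), hankelKernel s (x + y * I)) -
      s * (∫ x : ℝ in Ioi (0 : ℝ), g (x + y * I)) = - g (y * I) := fun y hy => by
    have h1 := integrableOn_hankelKernel_ray s 0 hy
    have h2 := (integrableOn_hankelKernel_ray (s + 1) 0 hy).const_mul s
    rw [← integral_const_mul, ← integral_sub h1 h2]
    have hd : ∀ x ∈ Ici (0 : ℝ), HasDerivAt (fun x : ℝ => g (x + y * I))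
        (hankelKernel s (x + y * I) - s * g (x + y * I)) x := fun x _ => by
      exact ((hg (x + y * I)).comp_add_const (x : ℂ) (y * I)).comp_ofReal
    have ht : Tendsto (fun x : ℝ => g (x + y * I)) atTop (𝓝 0) := by
      have hlim := (tendsto_exp_neg_mul_exp_add (neg_pos.2 hy) (1 - (s + 1).re)).const_mul
        (Real.exp ((s + 1).im * y))
      rw [mul_zero] at hlim
      refine squeeze_zero_norm (fun x => ?_) hlim
      rw [norm_hankelKernel, ← Real.exp_add, Real.exp_le_exp]
      linarith
    rw [integral_Ioi_of_hasDerivAt_of_tendsto' hd (h1.sub h2) ht]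
    simp
  have hu := hray Real.pi (by simp)
  have hl := hray (-Real.pi) (by simp)
  have hseg : I * (∫ y : ℝ in (-Real.pi)..Real.pi, hankelKernel s ((0 : ℝ) + y * I)) -
      s * (I * ∫ y : ℝ in (-Real.pi)..Real.pi, g ((0 : ℝ) + y * I)) =
      g (Real.pi * I) - g ((-Real.pi : ℝ) * I) := by
    have hd : ∀ y : ℝ, HasDerivAt (fun y : ℝ => g ((0 : ℝ) + y * I))
        (I * (hankelKernel s ((0 : ℝ) + y * I) - s * g ((0 : ℝ) + y * I))) y := fun y => by
      have h := (((hasDerivAt_id (y : ℂ)).mul_const I).const_add ((0 : ℝ) : ℂ))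
      have := ((hg ((0 : ℝ) + y * I)).comp (y : ℂ) h).comp_ofReal
      rw [one_mul, mul_comm] at this
      exact this
    have hc : ∀ r, Continuous fun y : ℝ => hankelKernel r ((0 : ℝ) + y * I) := fun r =>
      (continuous_hankelKernel r).comp (by fun_prop)
    have h := intervalIntegral.integral_eq_sub_of_hasDerivAt (fun y _ => hd y)
      (((hc s).sub ((hc (s + 1)).const_mul s)).const_mul I |>.intervalIntegrable
        (-Real.pi) Real.pi)
    rw [intervalIntegral.integral_const_mul, intervalIntegral.integral_sub
      ((hc s).intervalIntegrable _ _) (((hc (s + 1)).const_mul s).intervalIntegrable _ _),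
      intervalIntegral.integral_const_mul] at h
    simp only [ofReal_zero, zero_add] at h ⊢
    linear_combination h
  unfold hankelIntegral
  linear_combination hu - hl + hseg

/-- Hankel's formula for the reciprocal Gamma function. -/
theorem hankelIntegral_hankelKernel (s : ℂ) (a : ℝ) {θ : ℝ} (hθ : Real.pi / 2 < θ)
    (hθπ : θ ≤ Real.pi) :
    hankelIntegral θ a (hankelKernel s) = 2 * Real.pi * I * (Gamma s)⁻¹ := by
  rw [hankelIntegral_hankelKernel_eq_pi s a hθ hθπ,
    hankelIntegral_hankelKernel_abscissa s a 0 Real.pi_pos.le (by simp)]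
  obtain ⟨n, hn⟩ := exists_nat_gt (s.re - 1)
  have h : ∀ n : ℕ, ∀ s : ℂ, s.re < n + 1 →
      hankelIntegral Real.pi 0 (hankelKernel s) = 2 * Real.pi * I * (Gamma s)⁻¹ := fun n => by
    induction n with
    | zero => exact fun s hs => hankelIntegral_pi_of_re_lt_one (by simpa using hs) 0
    | succ n ih =>
      intro s hs
      rcases eq_or_ne s 1 with rfl | hs1
      · simp [hankelIntegral_pi_one]
      have h1 := hankelIntegral_pi_eq_mul_add_one (s - 1)
      have h2 := one_div_Gamma_eq_self_mul_one_div_Gamma_add_one (s - 1)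
      rw [ih (s - 1) (by push_cast at hs; simp only [sub_re, one_re]; linarith), h2,
        sub_add_cancel] at h1
      refine mul_left_cancel₀ (sub_ne_zero.2 hs1) ?_
      linear_combination -h1
  exact h n s (by linarith)

theorem hankelIntegral_const_mul (θ a : ℝ) (c : ℂ) (f : ℂ → ℂ) :
    hankelIntegral θ a (fun w => c * f w) = c * hankelIntegral θ a f := by
  simp only [hankelIntegral, integral_const_mul, intervalIntegral.integral_const_mul]
  ring

theorem HankelIntegrable.const_mul {θ a : ℝ} {f : ℂ → ℂ} (hf : HankelIntegrable θ a f) (c : ℂ) :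
    HankelIntegrable θ a fun w => c * f w :=
  ⟨hf.upper.const_mul c, hf.lower.const_mul c, hf.segment.const_mul c⟩

theorem hankelIntegral_add {θ a : ℝ} {f g : ℂ → ℂ} (hf : HankelIntegrable θ a f)
    (hg : HankelIntegrable θ a g) :
    hankelIntegral θ a (fun w => f w + g w) = hankelIntegral θ a f + hankelIntegral θ a g := by
  simp only [hankelIntegral]
  rw [integral_add hf.upper hg.upper, integral_add hf.lower hg.lower,
    intervalIntegral.integral_add hf.segment hg.segment]
  ring

theorem hankelIntegral_congr {θ a : ℝ} {f g : ℂ → ℂ} (hθ0 : 0 ≤ θ)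
    (hfg : ∀ w : ℂ, |w.im| ≤ θ → f w = g w) : hankelIntegral θ a f = hankelIntegral θ a g := by
  have hu : ∀ x : ℝ, f (x + θ * I) = g (x + θ * I) := fun x =>
    hfg _ (by simp [abs_of_nonneg hθ0])
  have hl : ∀ x : ℝ, f (x + (-θ : ℝ) * I) = g (x + (-θ : ℝ) * I) := fun x =>
    hfg _ (by simp [abs_of_nonneg hθ0])
  have hs : ∫ y : ℝ in (-θ)..θ, f (a + y * I) = ∫ y : ℝ in (-θ)..θ, g (a + y * I) :=
    intervalIntegral.integral_congr fun y hy => hfg _ (by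
      rw [uIcc_of_le (by linarith)] at hy
      simpa using abs_le.2 hy)
  simp only [hankelIntegral, hu, hl, hs]

theorem norm_hankelIntegral_le {θ a K : ℝ} {f g : ℂ → ℂ} (hθ0 : 0 ≤ θ)
    (hg : HankelIntegrable θ a g) (hle : ∀ w : ℂ, |w.im| ≤ θ → ‖f w‖ ≤ K * ‖g w‖) :
    ‖hankelIntegral θ a f‖ ≤ K * ((∫ x : ℝ in Ioi a, ‖g (x + θ * I)‖) +
      (∫ x : ℝ in Ioi a, ‖g (x + (-θ : ℝ) * I)‖) + ∫ y : ℝ in (-θ)..θ, ‖g (a + y * I)‖) := by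
  have hu := norm_integral_le_of_norm_le (hg.upper.norm.const_mul K)
    (ae_of_all _ fun x => hle (x + θ * I) (by simp [abs_of_nonneg hθ0]))
  have hl := norm_integral_le_of_norm_le (hg.lower.norm.const_mul K)
    (ae_of_all _ fun x => hle (x + (-θ : ℝ) * I) (by simp [abs_of_nonneg hθ0]))
  have hs := intervalIntegral.norm_integral_le_of_norm_le (by linarith : -θ ≤ θ)
    (ae_of_all _ fun y hy => hle (a + y * I) (by simpa using abs_le.2 (Ioc_subset_Icc_self hy)))
    (hg.segment.norm.const_mul K)
  rw [integral_const_mul] at hu hl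
  rw [intervalIntegral.integral_const_mul] at hs
  refine (norm_add_le _ _).trans ?_
  rw [norm_mul, norm_I, one_mul]
  linarith [norm_sub_le (∫ x : ℝ in Ioi a, f (x + θ * I)) (∫ x : ℝ in Ioi a, f (x + (-θ : ℝ) * I))]

/-- Termwise integration of a geometric series of ratio at most `1 / 2` in norm. -/
theorem hasSum_integral_geometric {α : Type*} {m : MeasurableSpace α} {ν : Measure α}
    {g u : α → ℂ} (hg : Integrable g ν) (hu : AEStronglyMeasurable u ν)
    (hle : ∀ᵐ x ∂ν, ‖u x‖ ≤ 1 / 2) :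
    HasSum (fun k : ℕ => ∫ x, u x ^ k * g x ∂ν) (∫ x, g x / (1 - u x) ∂ν) := by
  refine hasSum_integral_of_dominated_convergence (fun k x => (1 / 2) ^ k * ‖g x‖)
    (fun k => (hu.pow k).mul hg.1) (fun k => ?_) (ae_of_all _ fun x => ?_) ?_ ?_
  · filter_upwards [hle] with x hx
    rw [norm_mul, norm_pow]
    gcongr
  · exact summable_geometric_two.mul_right _
  · simp only [tsum_mul_right]
    exact hg.norm.const_mul _
  · filter_upwards [hle] with x hx
    rw [div_eq_inv_mul]
    exact (hasSum_geometric_of_norm_lt_one (hx.trans_lt (by norm_num))).mul_right _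

theorem hasSum_hankelIntegral_geometric {θ a : ℝ} {g u : ℂ → ℂ} (hθ0 : 0 ≤ θ)
    (hg : HankelIntegrable θ a g) (hu : Continuous u)
    (hle : ∀ w : ℂ, a ≤ w.re → ‖u w‖ ≤ 1 / 2) :
    HasSum (fun k : ℕ => hankelIntegral θ a fun w => u w ^ k * g w)
      (hankelIntegral θ a fun w => g w / (1 - u w)) := by
  have hray : ∀ y : ℝ, IntegrableOn (fun x : ℝ => g (x + y * I)) (Ioi a) →
      HasSum (fun k : ℕ => ∫ x : ℝ in Ioi a, u (x + y * I) ^ k * g (x + y * I))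
        (∫ x : ℝ in Ioi a, g (x + y * I) / (1 - u (x + y * I))) := fun y hy => by
    refine hasSum_integral_geometric hy
      (hu.comp (by fun_prop : Continuous fun x : ℝ => (x + y * I : ℂ))).aestronglyMeasurable ?_
    filter_upwards [ae_restrict_mem measurableSet_Ioi] with x hx
    exact hle _ (by simpa using (mem_Ioi.1 hx).le)
  have hseg := hasSum_integral_geometric
    ((intervalIntegrable_iff_integrableOn_Ioc_of_le (by linarith)).1 hg.segment)
    (hu.comp (by fun_prop : Continuous fun y : ℝ => (a + y * I : ℂ))).aestronglyMeasurable
    (ae_of_all _ fun y => hle _ (by simp))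
  unfold hankelIntegral
  simp only [intervalIntegral.integral_of_le (by linarith : -θ ≤ θ)]
  exact ((hray θ hg.upper).sub (hray (-θ) hg.lower)).add (hseg.mul_left I)

theorem cos_le_cos_of_le_abs {δ φ : ℝ} (hδ : 0 ≤ δ) (h1 : δ ≤ |φ|) (h2 : |φ| ≤ 2 * Real.pi - δ) :
    Real.cos φ ≤ Real.cos δ := by
  rw [← Real.cos_abs φ]
  rcases le_total |φ| Real.pi with h | h
  · exact Real.cos_le_cos_of_nonneg_of_le_pi hδ h h1
  · rw [← Real.cos_two_pi_sub |φ|]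
    exact Real.cos_le_cos_of_nonneg_of_le_pi hδ (by linarith) (by linarith)

theorem sin_le_norm_one_sub {u : ℂ} {δ : ℝ} (hu : u.re ≤ ‖u‖ * Real.cos δ) :
    Real.sin δ ≤ ‖1 - u‖ := by
  refine abs_le_of_sq_le_sq' ?_ (norm_nonneg _) |>.2
  have h : ‖1 - u‖ ^ 2 = 1 - 2 * u.re + ‖u‖ ^ 2 := by
    rw [← normSq_eq_norm_sq, ← normSq_eq_norm_sq, normSq_apply, normSq_apply]
    simp
    ring
  nlinarith [Real.sin_sq_add_cos_sq δ, sq_nonneg (‖u‖ - Real.cos δ)]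

theorem sin_le_norm_one_sub_inv {u : ℂ} {δ : ℝ} (hu0 : u ≠ 0) (hu : u.re ≤ ‖u‖ * Real.cos δ) :
    Real.sin δ ≤ ‖1 - u⁻¹‖ := by
  refine sin_le_norm_one_sub ?_
  have hpos := norm_pos_iff.2 hu0
  rw [inv_re, normSq_eq_norm_sq, norm_inv, div_le_iff₀ (by positivity)]
  field_simp
  exact hu

theorem re_mul_exp_le {ρ β θ : ℝ} {z w : ℂ} (hρ : 0 ≤ ρ) (hθ : ρ * θ ≤ β) (hβ : β ≤ Real.pi)
    (hz : β ≤ |z.arg|) (hw : |w.im| ≤ θ) :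
    (z * exp (-(ρ * w))).re ≤ ‖z * exp (-(ρ * w))‖ * Real.cos (β - ρ * θ) := by
  have hpolar : z * exp (-(ρ * w)) =
      ((‖z‖ * Real.exp (-(ρ * w.re)) : ℝ) : ℂ) * exp ((z.arg - ρ * w.im : ℝ) * I) := by
    conv_lhs => rw [← norm_mul_exp_arg_mul_I z, ← re_add_im w]
    push_cast
    simp only [mul_assoc, ← Complex.exp_add]
    ring_nf
  have hnonneg : 0 ≤ ‖z‖ * Real.exp (-(ρ * w.re)) := by positivity
  rw [hpolar, re_ofReal_mul, exp_ofReal_mul_I_re, norm_mul, norm_exp_ofReal_mul_I, mul_one,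
    norm_real, Real.norm_of_nonneg hnonneg]
  refine mul_le_mul_of_nonneg_left ?_ hnonneg
  have h1 : |ρ * w.im| ≤ ρ * θ := by
    rw [abs_mul, abs_of_nonneg hρ]
    gcongr
  have h2 := abs_arg_le_pi z
  refine cos_le_cos_of_le_abs (by linarith) ?_ ?_
  · linarith [abs_sub_abs_le_abs_sub z.arg (ρ * w.im)]
  · linarith [abs_sub z.arg (ρ * w.im)]

/-- The contour integral representation of the Mittag-Leffler function outside the sector
`|arg z| < β`. -/
theorem hankelIntegral_eq_mlE {ρ θ β : ℝ} {z : ℂ} (μ : ℂ) (hρ : 0 < ρ) (hθ1 : Real.pi / 2 < θ)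
    (hθ2 : θ ≤ Real.pi) (hθβ : ρ * θ < β) (hβ : β ≤ Real.pi) (hz1 : 1 ≤ ‖z‖)
    (hz : β ≤ |z.arg|) :
    hankelIntegral θ 0 (fun w => hankelKernel μ w / (1 - z * exp (-(ρ * w)))) =
      2 * Real.pi * I * mlE ρ μ z := by
  have hpi := Real.pi_pos
  have hθ0 : 0 ≤ θ := by linarith
  have hcos : Real.cos θ < 0 := Real.cos_neg_of_pi_div_two_lt_of_lt hθ1 (by linarith)
  have hsin : 0 < Real.sin (β - ρ * θ) :=
    Real.sin_pos_of_pos_of_lt_pi (by linarith) (by nlinarith)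
  have hlow : ∀ w : ℂ, |w.im| ≤ θ → Real.sin (β - ρ * θ) ≤ ‖1 - z * exp (-(ρ * w))‖ :=
    fun w hw => sin_le_norm_one_sub (re_mul_exp_le hρ.le hθβ.le hβ hz hw)
  have hdiff : ∀ w : ℂ, |w.im| ≤ θ →
      DifferentiableAt ℂ (fun w => hankelKernel μ w / (1 - z * exp (-(ρ * w)))) w := fun w hw =>
    (differentiable_hankelKernel μ w).div (by fun_prop)
      (norm_pos_iff.1 (hsin.trans_le (hlow w hw)))
  have hintg : HankelIntegrable θ 0 fun w => hankelKernel μ w / (1 - z * exp (-(ρ * w))) :=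
    hankelIntegrable_of_norm_le (K := (Real.sin (β - ρ * θ))⁻¹) (s := μ) hθ0 hcos hdiff
      fun w hw => by
        rw [norm_div, div_eq_inv_mul]
        gcongr
        exact hlow w hw
  have hz0 : 0 < 2 * ‖z‖ := by linarith
  set a := Real.log (2 * ‖z‖) / ρ with ha
  have ha0 : 0 ≤ a := div_nonneg (Real.log_nonneg (by linarith)) hρ.le
  have hsmall : ∀ w : ℂ, a ≤ w.re → ‖z * exp (-(ρ * w))‖ ≤ 1 / 2 := fun w hw => by
    have h1 : Real.log (2 * ‖z‖) ≤ ρ * w.re := by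
      rwa [ha, div_le_iff₀' hρ] at hw
    have h2 : Real.exp (-(ρ * w.re)) ≤ (2 * ‖z‖)⁻¹ := by
      rw [Real.exp_neg, ← Real.exp_log hz0]
      gcongr
    rw [norm_mul, norm_exp, neg_re, re_ofReal_mul]
    refine (mul_le_mul_of_nonneg_left h2 (norm_nonneg z)).trans_eq ?_
    have : ‖z‖ ≠ 0 := by linarith
    field_simp
  have hsum := hasSum_hankelIntegral_geometric hθ0 (hankelIntegrable_hankelKernel μ a hθ0 hcos)
    (u := fun w => z * exp (-(ρ * w))) (by fun_prop) hsmall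
  have hterm : ∀ k : ℕ, hankelIntegral θ a (fun w => (z * exp (-(ρ * w))) ^ k * hankelKernel μ w) =
      2 * Real.pi * I * (z ^ k / Gamma (((ρ * k : ℝ) : ℂ) + μ)) := fun k => by
    have : (fun w => (z * exp (-(ρ * w))) ^ k * hankelKernel μ w) =
        fun w => z ^ k * hankelKernel (((ρ * k : ℝ) : ℂ) + μ) w := by
      ext w
      rw [mul_pow, ← Complex.exp_nat_mul, mul_assoc,
        show (k : ℂ) * -(ρ * w) = (-((ρ * k : ℝ) : ℂ)) * w by push_cast; ring,
        exp_mul_hankelKernel]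
      ring_nf
    rw [this, hankelIntegral_const_mul, hankelIntegral_hankelKernel _ _ hθ1 hθ2]
    ring
  rw [hankelIntegral_eq_of_le hθ0 ha0 hdiff hintg, ← hsum.tsum_eq, mlE, ← tsum_mul_left]
  exact tsum_congr hterm

/-- Asymptotics of the Mittag-Leffler function in the sector
`β ≤ |arg z| ≤ π`:  `E_{ρ,μ}(z) = -z⁻¹/Γ(μ-ρ) + O(|z|⁻²)`. -/
theorem mittagLeffler_asymptotics
    (ρ : ℝ) (hρ0 : 0 < ρ) (hρ1 : ρ < 1) (μ : ℂ) (β : ℝ)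
    (hβ1 : Real.pi * ρ / 2 < β) (hβ2 : β < Real.pi * ρ) :
    ∃ C > (0:ℝ), ∃ R ≥ (1:ℝ), ∀ z : ℂ, R ≤ ‖z‖ →
      β ≤ |z.arg| → |z.arg| ≤ Real.pi →
      ‖mlE ρ μ z + z⁻¹ / Complex.Gamma (μ - (ρ : ℂ))‖ ≤ C / ‖z‖ ^ 2 := by
  have hpi := Real.pi_pos
  obtain ⟨θ, hθ1, hθ2⟩ : ∃ θ, Real.pi / 2 < θ ∧ θ < β / ρ :=
    exists_between (by rw [lt_div_iff₀ hρ0]; linarith)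
  rw [lt_div_iff₀' hρ0] at hθ2
  have hθπ : θ ≤ Real.pi := by
    by_contra! h
    nlinarith
  have hβπ : β ≤ Real.pi := by nlinarith
  have hθ0 : 0 ≤ θ := by linarith
  have hcos : Real.cos θ < 0 := Real.cos_neg_of_pi_div_two_lt_of_lt hθ1 (by linarith)
  set κ := Real.sin (β - ρ * θ)
  have hκ : 0 < κ := Real.sin_pos_of_pos_of_lt_pi (by linarith) (by nlinarith)
  set g := hankelKernel (μ - ρ - ρ)
  have hg : HankelIntegrable θ 0 g := hankelIntegrable_hankelKernel _ 0 hθ0 hcos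
  set N := (∫ x : ℝ in Ioi (0 : ℝ), ‖g (x + θ * I)‖) +
    (∫ x : ℝ in Ioi (0 : ℝ), ‖g (x + (-θ : ℝ) * I)‖) +
    ∫ y : ℝ in (-θ)..θ, ‖g ((0 : ℝ) + y * I)‖
  have hN : 0 ≤ κ⁻¹ * N :=
    (norm_nonneg _).trans (norm_hankelIntegral_le (f := 0) hθ0 hg fun w _ => by
      simpa using by positivity)
  refine ⟨κ⁻¹ * N + 1, by linarith, 1, le_rfl, fun z hz1 hz _ => ?_⟩
  have hz0 : z ≠ 0 := norm_pos_iff.1 (by linarith)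
  set u : ℂ → ℂ := fun w => z * exp (-(ρ * w))
  have hu0 : ∀ w, u w ≠ 0 := fun w => mul_ne_zero hz0 (Complex.exp_ne_zero _)
  have hlow : ∀ w : ℂ, |w.im| ≤ θ → κ ≤ ‖1 - u w‖ ∧ κ ≤ ‖1 - (u w)⁻¹‖ := fun w hw =>
    have h := re_mul_exp_le hρ0.le hθ2.le hβπ hz hw
    ⟨sin_le_norm_one_sub h, sin_le_norm_one_sub_inv (hu0 w) h⟩
  set f : ℂ → ℂ := fun w => g w / ((u w)⁻¹ - 1)
  have hf : ∀ w : ℂ, |w.im| ≤ θ → ‖f w‖ ≤ κ⁻¹ * ‖g w‖ := fun w hw => by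
    rw [norm_div, div_eq_inv_mul, norm_sub_rev]
    gcongr
    exact (hlow w hw).2
  have hfint : HankelIntegrable θ 0 f := by
    refine hankelIntegrable_of_norm_le hθ0 hcos (fun w hw => ?_) hf
    refine (differentiable_hankelKernel _ w).div
      (((by fun_prop : DifferentiableAt ℂ u w).inv (hu0 w)).sub_const 1) (norm_pos_iff.1 ?_)
    rw [norm_sub_rev]
    exact hκ.trans_le (hlow w hw).2
  have hsplit : ∀ w : ℂ, |w.im| ≤ θ → hankelKernel μ w / (1 - u w) =
      -z⁻¹ * hankelKernel (μ - ρ) w + (z ^ 2)⁻¹ * f w := fun w hw => by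
    have h1 : 1 - u w ≠ 0 := norm_pos_iff.1 (hκ.trans_le (hlow w hw).1)
    have hinv : (u w)⁻¹ = z⁻¹ * exp (ρ * w) := by
      rw [mul_inv, Complex.exp_neg, inv_inv]
    have h2 : (1 - u w)⁻¹ = -(u w)⁻¹ + (u w)⁻¹ ^ 2 * ((u w)⁻¹ - 1)⁻¹ := by
      have h3 : (u w)⁻¹ - 1 = (1 - u w) / u w := by
        rw [sub_div, one_div, div_self (hu0 w)]
      have := hu0 w
      rw [h3]
      field_simp
      ring
    have h4 : g w = exp (ρ * w) * (exp (ρ * w) * hankelKernel μ w) := by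
      rw [exp_mul_hankelKernel, exp_mul_hankelKernel]
    simp only [f]
    rw [← exp_mul_hankelKernel μ ρ, h4, div_eq_mul_inv, div_eq_mul_inv, h2]
    generalize ((u w)⁻¹ - 1)⁻¹ = v
    rw [hinv]
    ring
  have hrep := hankelIntegral_eq_mlE μ hρ0 hθ1 hθπ hθ2 hβπ hz1 hz
  have hmain : HankelIntegrable θ 0 fun w => -z⁻¹ * hankelKernel (μ - ρ) w :=
    (hankelIntegrable_hankelKernel (μ - ρ) 0 hθ0 hcos).const_mul _
  rw [hankelIntegral_congr hθ0 hsplit, hankelIntegral_add hmain (hfint.const_mul _),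
    hankelIntegral_const_mul, hankelIntegral_const_mul,
    hankelIntegral_hankelKernel _ _ hθ1 hθπ] at hrep
  have hbound := norm_hankelIntegral_le hθ0 hg hf
  have hkey : 2 * Real.pi * I * (mlE ρ μ z + z⁻¹ / Gamma (μ - ρ)) =
      (z ^ 2)⁻¹ * hankelIntegral θ 0 f := by
    linear_combination -hrep
  have hnorm := congrArg norm hkey
  simp only [norm_mul, norm_inv, norm_pow, norm_I, Complex.norm_ofNat, norm_real,
    Real.norm_of_nonneg hpi.le, mul_one] at hnorm
  have h2pi : 1 ≤ 2 * Real.pi := by linarith [Real.two_le_pi]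
  calc ‖mlE ρ μ z + z⁻¹ / Gamma (μ - ρ)‖
      ≤ 2 * Real.pi * ‖mlE ρ μ z + z⁻¹ / Gamma (μ - ρ)‖ :=
        le_mul_of_one_le_left (norm_nonneg _) h2pi
    _ = ‖hankelIntegral θ 0 f‖ / ‖z‖ ^ 2 := by rw [hnorm, div_eq_inv_mul]
    _ ≤ (κ⁻¹ * N + 1) / ‖z‖ ^ 2 := by
        gcongr
        linarith
end

section
/- Let 0<ρ<1, let μ∈ℂ, and let β be a fixed real number with πρ/2 < β < πρ. Then there exists a constant M>0, independent of z, such that for every z∈ℂ with β ≤ |arg z| ≤ π one has |E_{ρ,μ}(z)| ≤ M/(1+|z|). -/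
open Complex MeasureTheory Set Filter Topology

namespace MittagLeffler

/-- The closed half-strip `a ≤ re w`, `|im w| ≤ φ`. -/
def halfStrip (φ a : ℝ) : Set ℂ := {w | a ≤ w.re ∧ |w.im| ≤ φ}

/-- The integral of `exp (exp w) * h w` along the horizontal ray `im w = θ`, `re w > a`. -/
noncomputable def rayIntegral (θ a : ℝ) (h : ℂ → ℂ) : ℂ :=
  ∫ x : ℝ in Ioi a, cexp (cexp (x + θ * I)) * h (x + θ * I)

/-- The integral of `exp (exp w) * h w` along the boundary of `halfStrip φ a`. Under `ζ = exp w`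
this is a Hankel contour around the negative real axis. -/
noncomputable def loopIntegral (φ a : ℝ) (h : ℂ → ℂ) : ℂ :=
  rayIntegral φ a h - rayIntegral (-φ) a h +
    I * ∫ y : ℝ in (-φ)..φ, cexp (cexp (a + y * I)) * h (a + y * I)

lemma mem_halfStrip {φ a x y : ℝ} (hx : a ≤ x) (hy : |y| ≤ φ) :
    (x + y * I : ℂ) ∈ halfStrip φ a := by
  simpa [halfStrip] using ⟨hx, hy⟩

lemma norm_exp_exp (x y : ℝ) :
    ‖cexp (cexp (x + y * I))‖ = Real.exp (Real.exp x * Real.cos y) := by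
  simp [Complex.norm_exp, Complex.exp_re]

lemma tendsto_exp_neg_exp_mul_exp {k : ℝ} (hk : 0 < k) (c : ℝ) :
    Tendsto (fun x : ℝ => Real.exp (-k * Real.exp x) * Real.exp (c * x)) atTop (𝓝 0) := by
  refine ((tendsto_rpow_mul_exp_neg_mul_atTop_nhds_zero c k hk).comp
    Real.tendsto_exp_atTop).congr fun x => ?_
  simp only [Function.comp, ← Real.exp_mul]
  rw [mul_comm, mul_comm x c]

lemma integrableOn_exp_neg_exp_mul_exp {k : ℝ} (hk : 0 < k) (c a : ℝ) :
    IntegrableOn (fun x : ℝ => Real.exp (-k * Real.exp x) * Real.exp (c * x)) (Ioi a) := by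
  refine integrable_of_isBigO_exp_neg one_pos (by fun_prop) ?_
  refine Asymptotics.IsLittleO.isBigO ?_
  refine Asymptotics.isLittleO_of_tendsto (fun x hx => absurd hx (Real.exp_pos _).ne') ?_
  refine (tendsto_exp_neg_exp_mul_exp hk (c + 1)).congr fun x => ?_
  rw [mul_div_assoc, ← Real.exp_sub]
  ring_nf

lemma continuousOn_horizontal {φ a θ : ℝ} {h : ℂ → ℂ} (hθ : |θ| ≤ φ)
    (hc : ContinuousOn h (halfStrip φ a)) :
    ContinuousOn (fun x : ℝ => cexp (cexp (x + θ * I)) * h (x + θ * I)) (Ici a) := by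
  refine ContinuousOn.mul (by fun_prop) (hc.comp (by fun_prop) fun x hx => mem_halfStrip hx hθ)

lemma continuousOn_vertical {φ a : ℝ} {h : ℂ → ℂ}
    (hc : ContinuousOn h (halfStrip φ a)) :
    ContinuousOn (fun y : ℝ => cexp (cexp (a + y * I)) * h (a + y * I)) (Icc (-φ) φ) := by
  refine ContinuousOn.mul (by fun_prop)
    (hc.comp (by fun_prop) fun y hy => mem_halfStrip le_rfl (abs_le.2 hy))

lemma norm_integrand_le {φ a C c k x y : ℝ} {h : ℂ → ℂ}
    (hb : ∀ w ∈ halfStrip φ a, ‖h w‖ ≤ C * Real.exp (c * w.re)) (hx : a ≤ x) (hy : |y| ≤ φ)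
    (hk : Real.cos y ≤ -k) :
    ‖cexp (cexp (x + y * I)) * h (x + y * I)‖ ≤
      C * (Real.exp (-k * Real.exp x) * Real.exp (c * x)) := by
  have h1 := hb _ (mem_halfStrip hx hy)
  simp only [add_re, ofReal_re, mul_re, I_re, mul_zero, ofReal_im, I_im, zero_mul, sub_self,
    add_zero] at h1
  rw [norm_mul, norm_exp_exp, mul_left_comm, mul_comm (Real.exp x)]
  gcongr

lemma cos_le_of_le_abs {φ y : ℝ} (hφ : 0 ≤ φ) (h1 : φ ≤ |y|) (h2 : |y| ≤ Real.pi) :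
    Real.cos y ≤ - -Real.cos φ := by
  rw [neg_neg, ← Real.cos_abs y]
  exact Real.cos_le_cos_of_nonneg_of_le_pi hφ h2 h1

lemma neg_cos_pos {φ : ℝ} (h1 : Real.pi / 2 < φ) (h2 : φ ≤ Real.pi) : 0 < -Real.cos φ := by
  have := Real.cos_neg_of_pi_div_two_lt_of_lt h1 (by linarith [Real.pi_pos])
  linarith

lemma integrableOn_horizontal {φ a C c θ : ℝ} {h : ℂ → ℂ} (h1 : Real.pi / 2 < |θ|)
    (h2 : |θ| ≤ Real.pi) (hθ : |θ| ≤ φ) (hc : ContinuousOn h (halfStrip φ a))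
    (hb : ∀ w ∈ halfStrip φ a, ‖h w‖ ≤ C * Real.exp (c * w.re)) :
    IntegrableOn (fun x : ℝ => cexp (cexp (x + θ * I)) * h (x + θ * I)) (Ioi a) := by
  refine Integrable.mono' ((integrableOn_exp_neg_exp_mul_exp (neg_cos_pos h1 h2) c a).const_mul C)
    (((continuousOn_horizontal hθ hc).mono Ioi_subset_Ici_self).aestronglyMeasurable
      measurableSet_Ioi) ?_
  filter_upwards [ae_restrict_mem measurableSet_Ioi] with x hx
  exact norm_integrand_le hb (le_of_lt hx) hθ (cos_le_of_le_abs (abs_nonneg _) le_rfl h2)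

lemma rect_integral_eq_zero {φ a b θ₁ θ₂ : ℝ} {h : ℂ → ℂ}
    (hd : DifferentiableOn ℂ h (halfStrip φ a)) (hab : a ≤ b) (h1 : |θ₁| ≤ φ) (h2 : |θ₂| ≤ φ) :
    (∫ x : ℝ in a..b, cexp (cexp (x + θ₁ * I)) * h (x + θ₁ * I)) -
      (∫ x : ℝ in a..b, cexp (cexp (x + θ₂ * I)) * h (x + θ₂ * I)) +
      I * (∫ y : ℝ in θ₁..θ₂, cexp (cexp (b + y * I)) * h (b + y * I)) -
      I * (∫ y : ℝ in θ₁..θ₂, cexp (cexp (a + y * I)) * h (a + y * I)) = 0 := by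
  have := Complex.integral_boundary_rect_eq_zero_of_differentiableOn
    (fun w => cexp (cexp w) * h w) (a + θ₁ * I) (b + θ₂ * I) ?_
  · simpa using this
  · refine DifferentiableOn.mul (by fun_prop) (hd.mono ?_)
    intro w hw
    simp only [add_re, ofReal_re, mul_re, I_re, mul_zero, ofReal_im, I_im, mul_one, sub_self,
      add_zero, add_im, mul_im, zero_add, mem_reProdIm, uIcc_of_le hab] at hw
    refine ⟨hw.1.1, abs_le.2 ?_⟩
    have h3 := hw.2
    rw [abs_le] at h1 h2
    rcases le_total θ₁ θ₂ with h | h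
    · rw [uIcc_of_le h] at h3
      exact ⟨h1.1.trans h3.1, h3.2.trans h2.2⟩
    · rw [uIcc_of_ge h] at h3
      exact ⟨h2.1.trans h3.1, h3.2.trans h1.2⟩

/-- The loop integral does not depend on the position of the vertical segment. -/
lemma loopIntegral_shift {φ a b C c : ℝ} {h : ℂ → ℂ} (hφ : Real.pi / 2 < φ) (hφ' : φ ≤ Real.pi)
    (hd : DifferentiableOn ℂ h (halfStrip φ a)) (hab : a ≤ b)
    (hb : ∀ w ∈ halfStrip φ a, ‖h w‖ ≤ C * Real.exp (c * w.re)) :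
    loopIntegral φ a h = loopIntegral φ b h := by
  have h0 : |φ| = φ := abs_of_pos (by linarith [Real.pi_pos])
  have e := rect_integral_eq_zero (θ₁ := -φ) (θ₂ := φ) hd hab (by rw [abs_neg, h0]) h0.le
  rw [← intervalIntegral.integral_Ioi_sub_Ioi (integrableOn_horizontal (by rwa [abs_neg, h0])
      (by rwa [abs_neg, h0]) (by rw [abs_neg, h0]) hd.continuousOn hb) hab,
    ← intervalIntegral.integral_Ioi_sub_Ioi (integrableOn_horizontal (by rwa [h0])
      (by rwa [h0]) h0.le hd.continuousOn hb) hab] at e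
  simp only [loopIntegral, rayIntegral]
  linear_combination -e

lemma rayIntegral_sub {φ ψ a C c θ₁ θ₂ : ℝ} {h : ℂ → ℂ} (hφ : Real.pi / 2 < φ)
    (hψ : ψ ≤ Real.pi) (hd : DifferentiableOn ℂ h (halfStrip ψ a))
    (hb : ∀ w ∈ halfStrip ψ a, ‖h w‖ ≤ C * Real.exp (c * w.re))
    (hθ : ∀ y ∈ uIcc θ₁ θ₂, φ ≤ |y| ∧ |y| ≤ ψ) :
    rayIntegral θ₂ a h - rayIntegral θ₁ a h =
      -(I * ∫ y : ℝ in θ₁..θ₂, cexp (cexp (a + y * I)) * h (a + y * I)) := by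
  have hφ0 : 0 ≤ φ := by linarith [Real.pi_pos]
  have m1 := hθ θ₁ left_mem_uIcc
  have m2 := hθ θ₂ right_mem_uIcc
  have i1 := integrableOn_horizontal (hφ.trans_le m1.1) (m1.2.trans hψ) m1.2 hd.continuousOn hb
  have i2 := integrableOn_horizontal (hφ.trans_le m2.1) (m2.2.trans hψ) m2.2 hd.continuousOn hb
  have t1 := intervalIntegral_tendsto_integral_Ioi a i1 tendsto_id
  have t2 := intervalIntegral_tendsto_integral_Ioi a i2 tendsto_id
  have t3 : Tendsto (fun b : ℝ => ∫ y : ℝ in θ₁..θ₂, cexp (cexp (b + y * I)) * h (b + y * I))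
      atTop (𝓝 0) := by
    have hk := neg_cos_pos hφ ((m1.1.trans m1.2).trans hψ)
    refine squeeze_zero_norm' ?_ (by simpa only [mul_zero, zero_mul] using
      ((tendsto_exp_neg_exp_mul_exp hk c).const_mul C).mul_const |θ₂ - θ₁|)
    filter_upwards [eventually_ge_atTop a] with b hab
    refine intervalIntegral.norm_integral_le_of_norm_le_const fun y hy => ?_
    have m3 := hθ y (uIoc_subset_uIcc hy)
    exact norm_integrand_le hb hab m3.2 (cos_le_of_le_abs hφ0 m3.1 (m3.2.trans hψ))
  have t4 := ((t1.sub t2).add (t3.const_mul I)).sub (tendsto_const_nhds (x :=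
    I * (∫ y : ℝ in θ₁..θ₂, cexp (cexp (a + y * I)) * h (a + y * I))))
  have e := tendsto_nhds_unique (t4.congr' ?_) (tendsto_const_nhds (x := (0 : ℂ)))
  · simp only [rayIntegral]
    linear_combination -e
  · filter_upwards [eventually_ge_atTop a] with b hab
    exact rect_integral_eq_zero hd hab m1.2 m2.2

/-- The loop integral does not depend on the height of the half-strip. -/
lemma loopIntegral_widen {φ ψ a C c : ℝ} {h : ℂ → ℂ} (hφ : Real.pi / 2 < φ) (hφψ : φ ≤ ψ)
    (hψ : ψ ≤ Real.pi) (hd : DifferentiableOn ℂ h (halfStrip ψ a))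
    (hb : ∀ w ∈ halfStrip ψ a, ‖h w‖ ≤ C * Real.exp (c * w.re)) :
    loopIntegral φ a h = loopIntegral ψ a h := by
  have hφ0 : 0 < φ := by linarith [Real.pi_pos]
  have e1 := rayIntegral_sub (θ₁ := φ) (θ₂ := ψ) hφ hψ hd hb fun y hy => by
    rw [uIcc_of_le hφψ] at hy
    rw [abs_of_nonneg (hφ0.le.trans hy.1)]
    exact hy
  have e2 := rayIntegral_sub (θ₁ := -ψ) (θ₂ := -φ) hφ hψ hd hb fun y hy => by
    rw [uIcc_of_le (neg_le_neg hφψ)] at hy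
    rw [abs_of_nonpos (by linarith [hy.2])]
    exact ⟨by linarith [hy.2], by linarith [hy.1]⟩
  have hi : ∀ u v : ℝ, u ∈ Icc (-ψ) ψ → v ∈ Icc (-ψ) ψ → IntervalIntegrable
      (fun y : ℝ => cexp (cexp (a + y * I)) * h (a + y * I)) volume u v := fun u v hu hv =>
    ((continuousOn_vertical hd.continuousOn).mono
      (uIcc_subset_Icc hu hv)).intervalIntegrable
  have m1 : -ψ ∈ Icc (-ψ) ψ := ⟨le_rfl, by linarith⟩
  have m2 : -φ ∈ Icc (-ψ) ψ := ⟨by linarith, by linarith⟩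
  have m3 : φ ∈ Icc (-ψ) ψ := ⟨by linarith, by linarith⟩
  have m4 : ψ ∈ Icc (-ψ) ψ := ⟨by linarith, le_rfl⟩
  have s1 := intervalIntegral.integral_add_adjacent_intervals (hi _ _ m1 m2) (hi _ _ m2 m3)
  have s2 := intervalIntegral.integral_add_adjacent_intervals (hi _ _ m1 m3) (hi _ _ m3 m4)
  simp only [loopIntegral]
  rw [← s2, ← s1]
  linear_combination -e1 - e2

lemma norm_vertical_le {φ a C c y : ℝ} {h : ℂ → ℂ}
    (hb : ∀ w ∈ halfStrip φ a, ‖h w‖ ≤ C * Real.exp (c * w.re)) (hφ : 0 ≤ φ)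
    (hy : y ∈ uIoc (-φ) φ) :
    ‖cexp (cexp (a + y * I)) * h (a + y * I)‖ ≤
      C * (Real.exp (Real.exp a) * Real.exp (c * a)) := by
  rw [uIoc_of_le (by linarith)] at hy
  have := norm_integrand_le (k := -1) hb le_rfl (abs_le.2 ⟨hy.1.le, hy.2⟩)
    (by simpa using Real.cos_le_one y)
  rwa [neg_neg, one_mul] at this

lemma tendsto_rayIntegral {ι : Type*} {l : Filter ι} [l.IsCountablyGenerated] {φ a C c θ : ℝ}
    {H : ι → ℂ → ℂ} {h : ℂ → ℂ} (h1 : Real.pi / 2 < |θ|) (h2 : |θ| ≤ Real.pi) (hθ : |θ| ≤ φ)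
    (hc : ∀ n, ContinuousOn (H n) (halfStrip φ a))
    (hb : ∀ n, ∀ w ∈ halfStrip φ a, ‖H n w‖ ≤ C * Real.exp (c * w.re))
    (hl : ∀ w ∈ halfStrip φ a, Tendsto (fun n => H n w) l (𝓝 (h w))) :
    Tendsto (fun n => rayIntegral θ a (H n)) l (𝓝 (rayIntegral θ a h)) := by
  refine tendsto_integral_filter_of_dominated_convergence _
    (.of_forall fun n => ((continuousOn_horizontal hθ (hc n)).mono
      Ioi_subset_Ici_self).aestronglyMeasurable measurableSet_Ioi) (.of_forall fun n => ?_)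
    ((integrableOn_exp_neg_exp_mul_exp (neg_cos_pos h1 h2) c a).const_mul C) ?_
  · filter_upwards [ae_restrict_mem measurableSet_Ioi] with x hx
    exact norm_integrand_le (hb n) (le_of_lt hx) hθ (cos_le_of_le_abs (abs_nonneg _) le_rfl h2)
  · filter_upwards [ae_restrict_mem measurableSet_Ioi] with x hx
    exact (hl _ (mem_halfStrip (le_of_lt hx) hθ)).const_mul _

/-- Dominated convergence for loop integrals. -/
lemma tendsto_loopIntegral {ι : Type*} {l : Filter ι} [l.IsCountablyGenerated] {φ a C c : ℝ}
    {H : ι → ℂ → ℂ} {h : ℂ → ℂ} (hφ : Real.pi / 2 < φ) (hφ' : φ ≤ Real.pi)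
    (hc : ∀ n, ContinuousOn (H n) (halfStrip φ a))
    (hb : ∀ n, ∀ w ∈ halfStrip φ a, ‖H n w‖ ≤ C * Real.exp (c * w.re))
    (hl : ∀ w ∈ halfStrip φ a, Tendsto (fun n => H n w) l (𝓝 (h w))) :
    Tendsto (fun n => loopIntegral φ a (H n)) l (𝓝 (loopIntegral φ a h)) := by
  have hφ0 : 0 < φ := by linarith [Real.pi_pos]
  have h0 : |φ| = φ := abs_of_pos hφ0
  have h0' : |-φ| = φ := by rw [abs_neg, h0]
  refine ((tendsto_rayIntegral (by rwa [h0]) (by rwa [h0]) h0.le hc hb hl).sub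
    (tendsto_rayIntegral (by rwa [h0']) (by rwa [h0']) h0'.le hc hb hl)).add
    (Tendsto.const_mul I ?_)
  refine intervalIntegral.tendsto_integral_filter_of_dominated_convergence
    (fun _ => C * (Real.exp (Real.exp a) * Real.exp (c * a))) (.of_forall fun n => ?_)
    (.of_forall fun n => .of_forall fun y hy => norm_vertical_le (hb n) hφ0.le hy)
    intervalIntegrable_const (.of_forall fun y hy => ?_)
  · rw [uIoc_of_le (by linarith)]
    exact ((continuousOn_vertical (hc n)).mono Ioc_subset_Icc_self).aestronglyMeasurable
      measurableSet_Ioc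
  · rw [uIoc_of_le (by linarith)] at hy
    exact (hl _ (mem_halfStrip le_rfl (abs_le.2 ⟨hy.1.le, hy.2⟩))).const_mul _

lemma norm_rayIntegral_le {φ a C c θ : ℝ} {h : ℂ → ℂ} (h1 : Real.pi / 2 < |θ|)
    (h2 : |θ| ≤ Real.pi) (hθ : |θ| ≤ φ)
    (hb : ∀ w ∈ halfStrip φ a, ‖h w‖ ≤ C * Real.exp (c * w.re)) :
    ‖rayIntegral θ a h‖ ≤
      C * ∫ x in Ioi a, Real.exp (- -Real.cos |θ| * Real.exp x) * Real.exp (c * x) := by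
  rw [← integral_const_mul]
  refine norm_integral_le_of_norm_le
    ((integrableOn_exp_neg_exp_mul_exp (neg_cos_pos h1 h2) c a).const_mul C) ?_
  filter_upwards [ae_restrict_mem measurableSet_Ioi] with x hx
  exact norm_integrand_le hb (le_of_lt hx) hθ (cos_le_of_le_abs (abs_nonneg _) le_rfl h2)

lemma exists_norm_loopIntegral_le {φ : ℝ} (hφ : Real.pi / 2 < φ) (hφ' : φ ≤ Real.pi) (a c : ℝ) :
    ∃ D, ∀ (C : ℝ) (h : ℂ → ℂ), (∀ w ∈ halfStrip φ a, ‖h w‖ ≤ C * Real.exp (c * w.re)) →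
      ‖loopIntegral φ a h‖ ≤ C * D := by
  have hφ0 : 0 < φ := by linarith [Real.pi_pos]
  have h0 : |φ| = φ := abs_of_pos hφ0
  have h0' : |-φ| = φ := by rw [abs_neg, h0]
  refine ⟨(∫ x in Ioi a, Real.exp (- -Real.cos φ * Real.exp x) * Real.exp (c * x)) +
    (∫ x in Ioi a, Real.exp (- -Real.cos φ * Real.exp x) * Real.exp (c * x)) +
    (Real.exp (Real.exp a) * Real.exp (c * a)) * |φ - -φ|, fun C h hb => ?_⟩
  have b1 := norm_rayIntegral_le (by rwa [h0]) (by rwa [h0]) h0.le hb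
  have b2 := norm_rayIntegral_le (by rwa [h0']) (by rwa [h0']) h0'.le hb
  have b3 := intervalIntegral.norm_integral_le_of_norm_le_const
    fun y hy => norm_vertical_le hb hφ0.le hy
  rw [h0] at b1
  rw [h0'] at b2
  rw [mul_add, mul_add, ← mul_assoc C]
  refine (norm_add_le _ _).trans (add_le_add ((norm_sub_le _ _).trans (add_le_add b1 b2)) ?_)
  rwa [norm_mul, norm_I, one_mul]

lemma loopIntegral_const_mul (φ a : ℝ) (r : ℂ) (h : ℂ → ℂ) :
    loopIntegral φ a (fun w => r * h w) = r * loopIntegral φ a h := by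
  simp only [loopIntegral, rayIntegral, mul_left_comm _ r, integral_const_mul,
    intervalIntegral.integral_const_mul]
  ring

lemma loopIntegral_add {φ a C₁ c₁ C₂ c₂ : ℝ} {h₁ h₂ : ℂ → ℂ}
    (hφ : Real.pi / 2 < φ) (hφ' : φ ≤ Real.pi)
    (hc₁ : ContinuousOn h₁ (halfStrip φ a)) (hc₂ : ContinuousOn h₂ (halfStrip φ a))
    (hb₁ : ∀ w ∈ halfStrip φ a, ‖h₁ w‖ ≤ C₁ * Real.exp (c₁ * w.re))
    (hb₂ : ∀ w ∈ halfStrip φ a, ‖h₂ w‖ ≤ C₂ * Real.exp (c₂ * w.re)) :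
    loopIntegral φ a (fun w => h₁ w + h₂ w) = loopIntegral φ a h₁ + loopIntegral φ a h₂ := by
  have hφ0 : 0 < φ := by linarith [Real.pi_pos]
  have h0 : |φ| = φ := abs_of_pos hφ0
  have h0' : |-φ| = φ := by rw [abs_neg, h0]
  have hr : ∀ θ : ℝ, |θ| = φ → rayIntegral θ a (fun w => h₁ w + h₂ w) =
      rayIntegral θ a h₁ + rayIntegral θ a h₂ := fun θ hθ => by
    simp only [rayIntegral, mul_add]
    exact integral_add
      (integrableOn_horizontal (by rwa [hθ]) (by rwa [hθ]) hθ.le hc₁ hb₁)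
      (integrableOn_horizontal (by rwa [hθ]) (by rwa [hθ]) hθ.le hc₂ hb₂)
  have hi : ∀ h : ℂ → ℂ, ContinuousOn h (halfStrip φ a) → IntervalIntegrable
      (fun y : ℝ => cexp (cexp (a + y * I)) * h (a + y * I)) volume (-φ) φ := fun h hc =>
    ContinuousOn.intervalIntegrable (by
      rw [uIcc_of_le (by linarith)]
      exact continuousOn_vertical hc)
  simp only [loopIntegral, hr _ h0, hr _ h0', mul_add]
  rw [intervalIntegral.integral_add (hi _ hc₁) (hi _ hc₂)]
  ring

lemma norm_exp_mul_le (φ a : ℝ) (s : ℂ) :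
    ∀ w ∈ halfStrip φ a, ‖cexp (s * w)‖ ≤ Real.exp (|s.im| * φ) * Real.exp (s.re * w.re) := by
  rintro w ⟨-, hw⟩
  rw [Complex.norm_exp, ← Real.exp_add, Complex.mul_re]
  gcongr
  have := (neg_abs_le (s.im * w.im))
  have h2 : |s.im * w.im| ≤ |s.im| * φ := by rw [abs_mul]; gcongr
  linarith

/-- Integration by parts along the loop. -/
lemma loopIntegral_exp_eq_mul {φ : ℝ} (hφ : Real.pi / 2 < φ) (hφ' : φ ≤ Real.pi) (a : ℝ) (s : ℂ) :
    loopIntegral φ a (fun w => cexp ((1 - s) * w)) =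
      s * loopIntegral φ a (fun w => cexp (-s * w)) := by
  have hφ0 : 0 < φ := by linarith [Real.pi_pos]
  have h0 : |φ| = φ := abs_of_pos hφ0
  have h0' : |-φ| = φ := by rw [abs_neg, h0]
  have hb : ∀ w ∈ halfStrip φ a, ‖-s * cexp (-s * w)‖ ≤
      (‖-s‖ * Real.exp (|(-s).im| * φ)) * Real.exp ((-s).re * w.re) := fun w hw => by
    rw [norm_mul, mul_assoc]
    gcongr
    exact norm_exp_mul_le φ a (-s) w hw
  have key : loopIntegral φ a (fun w => cexp ((1 - s) * w) + -s * cexp (-s * w)) = 0 := by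
    have hder : ∀ w : ℂ, HasDerivAt (fun w => cexp (cexp w) * cexp (-s * w))
        (cexp (cexp w) * (cexp ((1 - s) * w) + -s * cexp (-s * w))) w := fun w => by
      have h1 := (Complex.hasDerivAt_exp w).cexp.mul (((hasDerivAt_id w).const_mul (-s)).cexp)
      refine h1.congr_deriv ?_
      have : (1 - s) * w = w + -s * w := by ring
      rw [this, Complex.exp_add]
      simp only [id]
      ring
    have hray : ∀ θ : ℝ, |θ| = φ →
        rayIntegral θ a (fun w => cexp ((1 - s) * w) + -s * cexp (-s * w)) =
          - (cexp (cexp (a + θ * I)) * cexp (-s * (a + θ * I))) := fun θ hθ => by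
      rw [← zero_sub (cexp _ * _)]
      refine integral_Ioi_of_hasDerivAt_of_tendsto'
        (f := fun x : ℝ => cexp (cexp (x + θ * I)) * cexp (-s * (x + θ * I)))
        (fun x _ => ?_) ?_ ?_
      · exact ((hder (x + θ * I)).comp_add_const (x : ℂ) (θ * I)).comp_ofReal
      · refine IntegrableOn.congr_fun ((integrableOn_horizontal (by rwa [hθ]) (by rwa [hθ]) hθ.le
          (by fun_prop) (norm_exp_mul_le φ a (1 - s))).add
          (integrableOn_horizontal (by rwa [hθ]) (by rwa [hθ]) hθ.le (by fun_prop) hb))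
          (fun x _ => ?_) measurableSet_Ioi
        simp only [Pi.add_apply]
        exact (mul_add _ _ _).symm
      · have ht := (tendsto_exp_neg_exp_mul_exp (neg_cos_pos hφ hφ') (-s).re).const_mul
          (Real.exp (|(-s).im| * φ))
        rw [mul_zero] at ht
        refine squeeze_zero_norm' ?_ ht
        filter_upwards [eventually_ge_atTop a] with x hx
        exact norm_integrand_le (norm_exp_mul_le φ a (-s)) hx hθ.le
          (cos_le_of_le_abs hφ0.le hθ.ge (hθ.le.trans hφ'))
    have hvert : I * ∫ y : ℝ in (-φ)..φ, cexp (cexp (a + y * I)) *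
        (cexp ((1 - s) * (a + y * I)) + -s * cexp (-s * (a + y * I))) =
        cexp (cexp (a + φ * I)) * cexp (-s * (a + φ * I)) -
        cexp (cexp (a + (-φ : ℝ) * I)) * cexp (-s * (a + (-φ : ℝ) * I)) := by
      rw [← intervalIntegral.integral_const_mul]
      refine intervalIntegral.integral_eq_sub_of_hasDerivAt
        (f := fun y : ℝ => cexp (cexp (a + y * I)) * cexp (-s * (a + y * I)))
        (fun y _ => ?_) (Continuous.intervalIntegrable (by fun_prop) _ _)
      have h2 : HasDerivAt (fun u : ℂ => a + u * I) I y := by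
        simpa using ((hasDerivAt_id (y : ℂ)).mul_const I).const_add (a : ℂ)
      rw [mul_comm I]
      exact ((hder (a + y * I)).comp (y : ℂ) h2).comp_ofReal
    rw [loopIntegral, hray _ h0, hray _ h0', hvert]
    ring
  rw [loopIntegral_add hφ hφ' (by fun_prop) (by fun_prop) (norm_exp_mul_le φ a (1 - s)) hb,
    loopIntegral_const_mul] at key
  linear_combination key

lemma integral_exp_neg_exp_eq (a : ℝ) (s : ℂ) :
    ∫ x : ℝ in Ioi a, cexp (-cexp x) * cexp (s * x) =
      ∫ r : ℝ in Ioi (Real.exp a), (Real.exp (-r) : ℂ) * (r : ℂ) ^ (s - 1) := by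
  have himg : Real.exp '' Ioi a = Ioi (Real.exp a) := by
    ext r
    simp only [mem_image, mem_Ioi]
    refine ⟨fun ⟨x, hx, e⟩ => e ▸ Real.exp_lt_exp.2 hx, fun hr => ?_⟩
    have hr0 := (Real.exp_pos a).trans hr
    exact ⟨Real.log r, (Real.lt_log_iff_exp_lt hr0).2 hr, Real.exp_log hr0⟩
  rw [← himg, integral_image_eq_integral_abs_deriv_smul measurableSet_Ioi
    (fun x _ => (Real.hasDerivAt_exp x).hasDerivWithinAt) Real.exp_injective.injOn]
  refine setIntegral_congr_fun measurableSet_Ioi fun x _ => ?_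
  have hx : (Real.exp x : ℂ) ≠ 0 := by exact_mod_cast (Real.exp_pos x).ne'
  rw [abs_of_pos (Real.exp_pos x), cpow_def_of_ne_zero hx, ← Complex.ofReal_log (Real.exp_pos x).le,
    Real.log_exp, Complex.real_smul]
  push_cast
  have : s * x = x + x * (s - 1) := by ring
  rw [this, Complex.exp_add]
  ring

lemma tendsto_integral_exp_neg_exp {s : ℂ} (hs : 0 < s.re) :
    Tendsto (fun a : ℝ => ∫ x : ℝ in Ioi a, cexp (-cexp x) * cexp (s * x)) atBot
      (𝓝 (Gamma s)) := by
  simp only [integral_exp_neg_exp_eq, Gamma_eq_integral hs, GammaIntegral]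
  have hcov : AECover (volume.restrict (Ioi (0 : ℝ))) atBot fun a : ℝ => Ioi (Real.exp a) :=
    aecover_Ioi_of_Ioi Real.tendsto_exp_atBot
  refine (hcov.integral_tendsto_of_countably_generated
    (GammaIntegral_convergent hs)).congr fun a => ?_
  rw [Measure.restrict_restrict measurableSet_Ioi,
    inter_eq_left.2 (Ioi_subset_Ioi (Real.exp_pos a).le)]

lemma rayIntegral_exp_of_exp_eq_neg_one {θ : ℝ} (hθ : cexp (θ * I) = -1) (a : ℝ) (s : ℂ) :
    rayIntegral θ a (fun w => cexp (s * w)) =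
      cexp (s * (θ * I)) * ∫ x : ℝ in Ioi a, cexp (-cexp x) * cexp (s * x) := by
  rw [rayIntegral, ← integral_const_mul]
  congr 1 with x
  rw [mul_add, Complex.exp_add x, hθ, Complex.exp_add]
  ring_nf

lemma inv_Gamma_eq {s : ℂ} (hs : s.re < 1) :
    (Real.pi : ℂ) * (Gamma s)⁻¹ = Complex.sin (Real.pi * s) * Gamma (1 - s) := by
  have hG : Gamma (1 - s) ≠ 0 := Gamma_ne_zero_of_re_pos (by simpa using hs)
  have h := Gamma_mul_Gamma_one_sub s
  have hpi : (Real.pi : ℂ) ≠ 0 := by exact_mod_cast Real.pi_ne_zero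
  by_cases h0 : Complex.sin (Real.pi * s) = 0
  · rw [h0, div_zero, mul_eq_zero, or_iff_left hG] at h
    simp [h, h0]
  · have hs0 : Gamma s ≠ 0 := fun h1 => by
      rw [h1, zero_mul] at h
      exact div_ne_zero hpi h0 h.symm
    rw [eq_div_iff h0] at h
    rw [← div_eq_mul_inv, div_eq_iff hs0]
    linear_combination -h

lemma loopIntegral_exp_of_re_lt_one {φ : ℝ} (hφ : Real.pi / 2 < φ) (hφ' : φ ≤ Real.pi) (a : ℝ)
    {s : ℂ} (hs : s.re < 1) :
    loopIntegral φ a (fun w => cexp ((1 - s) * w)) = 2 * Real.pi * I * (Gamma s)⁻¹ := by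
  have hpi := Real.pi_pos
  have hs' : 0 < (1 - s).re := by simpa using hs
  rw [loopIntegral_widen hφ hφ' le_rfl (by fun_prop) (norm_exp_mul_le Real.pi a (1 - s))]
  have hconst : ∀ᶠ b : ℝ in atBot, loopIntegral Real.pi b (fun w => cexp ((1 - s) * w)) =
      loopIntegral Real.pi a (fun w => cexp ((1 - s) * w)) := by
    filter_upwards [eventually_le_atBot a] with b hb
    exact loopIntegral_shift (by linarith) le_rfl (by fun_prop) hb
      (norm_exp_mul_le Real.pi b (1 - s))
  have hvert : Tendsto (fun b : ℝ => ∫ y : ℝ in (-Real.pi)..Real.pi, cexp (cexp (b + y * I)) *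
      cexp ((1 - s) * (b + y * I))) atBot (𝓝 0) := by
    have h1 : Tendsto (fun b : ℝ => Real.exp (|(1 - s).im| * Real.pi) * (Real.exp (Real.exp b) *
        Real.exp ((1 - s).re * b)) * |Real.pi - -Real.pi|) atBot (𝓝 0) := by
      have h2 := Real.tendsto_exp_atBot.comp (tendsto_id.const_mul_atBot hs')
      have h3 := (Real.continuous_exp.tendsto 0).comp Real.tendsto_exp_atBot
      simpa [Function.comp_def] using
        ((h3.mul h2).const_mul (Real.exp (|(1 - s).im| * Real.pi))).mul_const |Real.pi - -Real.pi|
    refine squeeze_zero_norm (fun b => ?_) h1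
    exact intervalIntegral.norm_integral_le_of_norm_le_const fun y hy =>
      norm_vertical_le (norm_exp_mul_le Real.pi b (1 - s)) hpi.le hy
  have hT := tendsto_integral_exp_neg_exp hs'
  have hlim := ((hT.const_mul (cexp ((1 - s) * (Real.pi * I)))).sub
    (hT.const_mul (cexp ((1 - s) * ((-Real.pi : ℝ) * I))))).add (hvert.const_mul I)
  have hlim' := tendsto_nhds_unique (hlim.congr' ?_) (tendsto_const_nhds
    (x := loopIntegral Real.pi a (fun w => cexp ((1 - s) * w))))
  · rw [← hlim', mul_right_comm, mul_assoc 2, inv_Gamma_eq hs]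
    have e1 : Complex.sin (Real.pi * s) = Complex.sin ((1 - s) * Real.pi) := by
      rw [← Complex.sin_pi_sub]
      ring_nf
    rw [e1, Complex.sin]
    push_cast
    ring_nf
    simp only [I_sq]
    ring
  · filter_upwards [hconst] with b hb
    rw [← hb, loopIntegral, rayIntegral_exp_of_exp_eq_neg_one (by simp),
      rayIntegral_exp_of_exp_eq_neg_one (by simp [Complex.exp_neg])]

/-- Hankel's formula for the reciprocal Gamma function. -/
lemma loopIntegral_exp {φ : ℝ} (hφ : Real.pi / 2 < φ) (hφ' : φ ≤ Real.pi) (a : ℝ) (s : ℂ) :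
    loopIntegral φ a (fun w => cexp ((1 - s) * w)) = 2 * Real.pi * I * (Gamma s)⁻¹ := by
  have hone : loopIntegral φ 0 (fun w => cexp ((1 - 1) * w)) =
      2 * Real.pi * I * (Gamma 1)⁻¹ := by
    have hu : Tendsto (fun n : ℕ => (1 : ℂ) - (1 / ((n : ℝ) + 1) : ℝ)) atTop (𝓝 1) := by
      simpa using tendsto_const_nhds.sub
        ((continuous_ofReal.tendsto 0).comp tendsto_one_div_add_atTop_nhds_zero_nat)
    have hr := ((differentiable_one_div_Gamma.continuous.tendsto 1).comp hu).const_mul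
      (2 * Real.pi * I : ℂ)
    refine tendsto_nhds_unique (tendsto_loopIntegral (C := 1) (c := 1) hφ hφ'
      (H := fun (n : ℕ) w => cexp ((1 - (1 - (1 / ((n : ℝ) + 1) : ℝ))) * w))
      (fun n => by fun_prop) (fun n w hw => ?_) fun w _ => ?_) (hr.congr fun n => ?_)
    · have h0 : (0 : ℝ) < n + 1 := by positivity
      have h1 : 1 / ((n : ℝ) + 1) ≤ 1 := by
        rw [div_le_one h0]
        linarith [Nat.cast_nonneg (α := ℝ) n]
      rw [sub_sub_cancel, Complex.norm_exp, re_ofReal_mul, one_mul]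
      exact Real.exp_le_exp.2 (mul_le_mul_of_nonneg_right h1 hw.1)
    · exact (Complex.continuous_exp.tendsto _).comp ((hu.const_sub 1).mul_const w)
    · have h0 : (0 : ℝ) < 1 / ((n : ℝ) + 1) := by positivity
      refine (loopIntegral_exp_of_re_lt_one hφ hφ' 0 ?_).symm
      rw [sub_re, ofReal_re, one_re]
      linarith
  have hone' : loopIntegral φ a (fun w => cexp ((1 - 1) * w)) =
      2 * Real.pi * I * (Gamma 1)⁻¹ := by
    rw [← hone]
    rcases le_total a 0 with h | h
    · exact loopIntegral_shift hφ hφ' (by fun_prop) h (norm_exp_mul_le φ a _)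
    · exact (loopIntegral_shift hφ hφ' (by fun_prop) h (norm_exp_mul_le φ 0 _)).symm
  obtain ⟨n, hn⟩ := exists_nat_gt s.re
  induction n generalizing s with
  | zero => exact loopIntegral_exp_of_re_lt_one hφ hφ' a (by push_cast at hn; linarith)
  | succ n ih =>
    by_cases h1 : s = 1
    · rw [h1, hone']
    · have h2 := ih (s - 1) (by push_cast at hn; simpa [sub_lt_iff_lt_add] using hn)
      have h3 : s - 1 ≠ 0 := sub_ne_zero.2 h1
      rw [loopIntegral_exp_eq_mul hφ hφ', one_div_Gamma_eq_self_mul_one_div_Gamma_add_one,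
        sub_add_cancel, neg_sub] at h2
      exact mul_left_cancel₀ h3 (by linear_combination h2)

lemma loopIntegral_finset_sum {ι : Type*} {φ a C c : ℝ} {f : ι → ℂ → ℂ}
    (hφ : Real.pi / 2 < φ) (hφ' : φ ≤ Real.pi)
    (hc : ∀ k, ContinuousOn (f k) (halfStrip φ a))
    (hb : ∀ s : Finset ι, ∀ w ∈ halfStrip φ a, ‖∑ k ∈ s, f k w‖ ≤ C * Real.exp (c * w.re))
    (s : Finset ι) :
    loopIntegral φ a (fun w => ∑ k ∈ s, f k w) = ∑ k ∈ s, loopIntegral φ a (f k) := by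
  classical
  induction s using Finset.induction_on with
  | empty => simp [loopIntegral, rayIntegral]
  | insert k s hk ih =>
    simp only [Finset.sum_insert hk]
    rw [loopIntegral_add hφ hφ' (hc k) (continuousOn_finsetSum s fun k _ => hc k)
      (by simpa using hb {k}) (hb s), ih]

lemma cos_le_cos_of_mem_Icc {δ t : ℝ} (hδ : 0 ≤ δ) (h1 : δ ≤ |t|) (h2 : |t| ≤ 2 * Real.pi - δ) :
    Real.cos t ≤ Real.cos δ := by
  rw [← Real.cos_abs t]
  rcases le_total |t| Real.pi with h | h
  · exact Real.cos_le_cos_of_nonneg_of_le_pi hδ h h1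
  · rw [← Real.cos_two_pi_sub |t|]
    exact Real.cos_le_cos_of_nonneg_of_le_pi hδ (by linarith) (by linarith)

lemma mul_add_le_norm_sub {R r θ α δ : ℝ} (hR : 0 ≤ R) (hr : 0 ≤ r)
    (h : Real.cos (α - θ) ≤ Real.cos δ) :
    √((1 - Real.cos δ) / 2) * (R + r) ≤ ‖R * cexp (θ * I) - r * cexp (α * I)‖ := by
  have h1 := Real.cos_le_one δ
  refine le_of_sq_le_sq ?_ (norm_nonneg _)
  rw [mul_pow, Real.sq_sqrt (by linarith), ← Complex.normSq_eq_norm_sq, Complex.normSq_apply]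
  simp only [sub_re, sub_im, re_ofReal_mul, im_ofReal_mul, exp_ofReal_mul_I_re,
    exp_ofReal_mul_I_im]
  rw [Real.cos_sub] at h
  have h2 := Real.sin_sq_add_cos_sq α
  have h3 := Real.sin_sq_add_cos_sq θ
  have h4 := Real.neg_one_le_cos δ
  have e : (R * Real.cos θ - r * Real.cos α) * (R * Real.cos θ - r * Real.cos α) +
      (R * Real.sin θ - r * Real.sin α) * (R * Real.sin θ - r * Real.sin α) =
      R ^ 2 + r ^ 2 - 2 * (R * r) * (Real.cos α * Real.cos θ + Real.sin α * Real.sin θ) := by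
    linear_combination R ^ 2 * h3 + r ^ 2 * h2
  rw [e]
  have h5 := mul_le_mul_of_nonneg_left h (mul_nonneg hR hr)
  nlinarith [mul_nonneg (by linarith : (0 : ℝ) ≤ 1 + Real.cos δ) (sq_nonneg (R - r))]

/-- In the sector `β ≤ |arg z|`, the point `z` stays away from the image of the strip
`|im w| ≤ φ` under `w ↦ exp (ρ w)`, provided `ρ φ ≤ β`. -/
lemma le_norm_one_sub_mul_exp {ρ β φ : ℝ} (hρ : 0 < ρ) (hβ : ρ * φ ≤ β) {z w : ℂ}
    (hz : β ≤ |z.arg|) (hw : |w.im| ≤ φ) :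
    √((1 - Real.cos (β - ρ * φ)) / 2) * (Real.exp (ρ * w.re) + ‖z‖) * Real.exp (-(ρ * w.re)) ≤
      ‖1 - z * cexp (-(ρ * w))‖ := by
  have hθ : |ρ * w.im| ≤ ρ * φ := by
    rw [abs_mul, abs_of_pos hρ]
    gcongr
  have hπ := Complex.abs_arg_le_pi z
  have hcos : Real.cos (z.arg - ρ * w.im) ≤ Real.cos (β - ρ * φ) := by
    refine cos_le_cos_of_mem_Icc (by linarith) ?_ ?_
    · linarith [abs_sub_abs_le_abs_sub z.arg (ρ * w.im)]
    · linarith [abs_sub z.arg (ρ * w.im)]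
  have h := mul_add_le_norm_sub (Real.exp_pos (ρ * w.re)).le (norm_nonneg z) hcos
  have e : cexp (ρ * w) = Real.exp (ρ * w.re) * cexp ((ρ * w.im : ℝ) * I) := by
    rw [Complex.ofReal_exp, ← Complex.exp_add]
    congr 1
    apply Complex.ext <;> simp
  rw [Complex.norm_mul_exp_arg_mul_I, ← e] at h
  have e2 : 1 - z * cexp (-(ρ * w)) = (cexp (ρ * w) - z) * cexp (-(ρ * w)) := by
    rw [sub_mul, ← Complex.exp_add, add_neg_cancel, Complex.exp_zero]
  have e3 : ‖cexp (-(ρ * w))‖ = Real.exp (-(ρ * w.re)) := by simp [Complex.norm_exp]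
  rw [e2, norm_mul, e3]
  gcongr

/-- The kernel obtained by summing the Mittag-Leffler series under the loop integral. -/
noncomputable def kernel (ρ : ℝ) (μ z w : ℂ) : ℂ :=
  cexp ((1 - μ) * w) * (1 - z * cexp (-(ρ * w)))⁻¹

lemma sqrt_one_sub_cos_div_two_pos {θ : ℝ} (hθ : 0 < θ) (hθ' : θ ≤ Real.pi) :
    0 < √((1 - Real.cos θ) / 2) := by
  have := Real.cos_lt_cos_of_nonneg_of_le_pi le_rfl hθ' hθ
  rw [Real.cos_zero] at this
  exact Real.sqrt_pos.2 (by linarith)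

lemma norm_kernel_le {ρ β φ : ℝ} (hρ : 0 < ρ) (hβ : ρ * φ < β) (hβπ : β - ρ * φ ≤ Real.pi)
    (μ : ℂ) {z : ℂ} (hz : β ≤ |z.arg|) :
    ∀ w ∈ halfStrip φ 0, ‖kernel ρ μ z w‖ ≤
      (Real.exp (|(1 - μ).im| * φ) / √((1 - Real.cos (β - ρ * φ)) / 2) / (1 + ‖z‖)) *
        Real.exp (((1 - μ).re + ρ) * w.re) := by
  intro w hw
  have hκ := sqrt_one_sub_cos_div_two_pos (sub_pos.2 hβ) hβπ
  set κ := √((1 - Real.cos (β - ρ * φ)) / 2)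
  have h1 := norm_exp_mul_le φ 0 (1 - μ) w hw
  have h2 : κ * (1 + ‖z‖) * Real.exp (-(ρ * w.re)) ≤ ‖1 - z * cexp (-(ρ * w))‖ := by
    refine le_trans ?_ (le_norm_one_sub_mul_exp hρ hβ.le hz hw.2)
    gcongr
    exact Real.one_le_exp (mul_nonneg hρ.le hw.1)
  rw [kernel, norm_mul, norm_inv]
  calc _ ≤ (Real.exp (|(1 - μ).im| * φ) * Real.exp ((1 - μ).re * w.re)) *
        (κ * (1 + ‖z‖) * Real.exp (-(ρ * w.re)))⁻¹ := by
        gcongr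
    _ = _ := by
        rw [add_mul, Real.exp_add, Real.exp_neg]
        field_simp

lemma differentiableOn_kernel {ρ β φ : ℝ} (hρ : 0 < ρ) (hβ : ρ * φ < β)
    (hβπ : β - ρ * φ ≤ Real.pi) (μ : ℂ) {z : ℂ} (hz : β ≤ |z.arg|) (a : ℝ) :
    DifferentiableOn ℂ (kernel ρ μ z) (halfStrip φ a) := by
  refine DifferentiableOn.mul (by fun_prop) (DifferentiableOn.inv (by fun_prop) fun w hw => ?_)
  have hκ := sqrt_one_sub_cos_div_two_pos (sub_pos.2 hβ) hβπ
  exact norm_pos_iff.1 (lt_of_lt_of_le (by positivity)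
    (le_norm_one_sub_mul_exp hρ hβ.le hz hw.2))

/-- Integral representation of the Mittag-Leffler function on a contour far to the right. -/
lemma hasSum_loopIntegral_kernel {ρ φ a : ℝ} (hρ : 0 < ρ) (hφ : Real.pi / 2 < φ)
    (hφ' : φ ≤ Real.pi) (μ : ℂ) {z : ℂ} (ha : ‖z‖ * Real.exp (-(ρ * a)) < 1) :
    HasSum (fun k : ℕ => 2 * Real.pi * I * (z ^ k / Gamma (((ρ * k : ℝ) : ℂ) + μ)))
      (loopIntegral φ a (kernel ρ μ z)) := by
  set q := ‖z‖ * Real.exp (-(ρ * a)) with hq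
  have hq0 : 0 ≤ q := by positivity
  have hzq : ∀ w ∈ halfStrip φ a, ‖z * cexp (-(ρ * w))‖ ≤ q := fun w hw => by
    have e3 : ‖cexp (-(ρ * w))‖ = Real.exp (-(ρ * w.re)) := by simp [Complex.norm_exp]
    rw [norm_mul, e3, hq]
    have := hw.1
    gcongr
  have hterm : ∀ (k : ℕ) (w : ℂ), z ^ k * cexp ((1 - (((ρ * k : ℝ) : ℂ) + μ)) * w) =
      cexp ((1 - μ) * w) * (z * cexp (-(ρ * w))) ^ k := fun k w => by
    rw [mul_pow, ← Complex.exp_nat_mul, mul_left_comm, ← Complex.exp_add]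
    congr 2
    push_cast
    ring
  have hb : ∀ s : Finset ℕ, ∀ w ∈ halfStrip φ a,
      ‖∑ k ∈ s, z ^ k * cexp ((1 - (((ρ * k : ℝ) : ℂ) + μ)) * w)‖ ≤
        (Real.exp (|(1 - μ).im| * φ) * (1 - q)⁻¹) * Real.exp ((1 - μ).re * w.re) := by
    intro s w hw
    simp only [hterm]
    rw [← Finset.mul_sum, norm_mul, mul_right_comm]
    refine mul_le_mul (norm_exp_mul_le φ a _ w hw) ?_ (norm_nonneg _) (by positivity)
    calc _ ≤ ∑ k ∈ s, q ^ k := norm_sum_le_of_le _ fun k _ => by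
          rw [norm_pow]
          exact pow_le_pow_left₀ (norm_nonneg _) (hzq w hw) k
      _ ≤ ∑' k : ℕ, q ^ k := (summable_geometric_of_lt_one hq0 ha).sum_le_tsum s
          fun k _ => by positivity
      _ = (1 - q)⁻¹ := tsum_geometric_of_lt_one hq0 ha
  have hc : ∀ k : ℕ, ContinuousOn (fun w => z ^ k * cexp ((1 - (((ρ * k : ℝ) : ℂ) + μ)) * w))
      (halfStrip φ a) := fun k => by fun_prop
  refine (tendsto_loopIntegral hφ hφ' (fun s => continuousOn_finsetSum s fun k _ => hc k)
    hb fun w hw => ?_).congr fun s => ?_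
  · change HasSum _ _
    simp only [hterm]
    exact (hasSum_geometric_of_norm_lt_one ((hzq w hw).trans_lt ha)).mul_left _
  · rw [loopIntegral_finset_sum hφ hφ' hc hb s]
    refine Finset.sum_congr rfl fun k _ => ?_
    rw [loopIntegral_const_mul, loopIntegral_exp hφ hφ']
    ring

end MittagLeffler

open MittagLeffler in
/-- Uniform bound `|E_{ρ,μ}(z)| ≤ M/(1+|z|)` in the sector
`β ≤ |arg z| ≤ π`. -/
theorem mittagLeffler_sector_bound
    (ρ : ℝ) (hρ0 : 0 < ρ) (hρ1 : ρ < 1) (μ : ℂ) (β : ℝ)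
    (hβ1 : Real.pi * ρ / 2 < β) (hβ2 : β < Real.pi * ρ) :
    ∃ M > (0:ℝ), ∀ z : ℂ, β ≤ |z.arg| → |z.arg| ≤ Real.pi →
      ‖mlE ρ μ z‖ ≤ M / (1 + ‖z‖) := by
  have hpi := Real.pi_pos
  obtain ⟨φ, hφ, hφβ⟩ : ∃ φ, Real.pi / 2 < φ ∧ φ < β / ρ :=
    exists_between (by rw [lt_div_iff₀ hρ0]; linarith)
  rw [lt_div_iff₀ hρ0, mul_comm] at hφβ
  have hφ' : φ ≤ Real.pi := (lt_of_mul_lt_mul_left (by linarith : ρ * φ < ρ * Real.pi) hρ0.le).le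
  have hβπ : β - ρ * φ ≤ Real.pi := by nlinarith
  obtain ⟨D, hD⟩ := exists_norm_loopIntegral_le hφ hφ' 0 ((1 - μ).re + ρ)
  set K := Real.exp (|(1 - μ).im| * φ) / √((1 - Real.cos (β - ρ * φ)) / 2) with hK
  have hK0 : 0 ≤ K := by positivity
  refine ⟨K * |D| / (2 * Real.pi) + 1, by positivity, fun z hz _ => ?_⟩
  have hz1 : 0 < 1 + ‖z‖ := by positivity
  have hA0 : 0 ≤ Real.log (1 + ‖z‖) / ρ :=
    div_nonneg (Real.log_nonneg (by linarith [norm_nonneg z])) hρ0.le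
  have hA : ‖z‖ * Real.exp (-(ρ * (Real.log (1 + ‖z‖) / ρ))) < 1 := by
    rw [mul_div_cancel₀ _ hρ0.ne', Real.exp_neg, Real.exp_log hz1, ← div_eq_mul_inv,
      div_lt_one hz1]
    linarith
  have hsum := (hasSum_loopIntegral_kernel hρ0 hφ hφ' μ hA).tsum_eq
  have hb := norm_kernel_le hρ0 hφβ hβπ μ hz
  rw [tsum_mul_left, ← loopIntegral_shift hφ hφ' (differentiableOn_kernel hρ0 hφβ hβπ μ hz 0)
    hA0 hb] at hsum
  have hn := hD _ _ hb
  rw [← hsum, norm_mul, ← hK] at hn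
  have e : ‖(2 * Real.pi * I : ℂ)‖ = 2 * Real.pi := by simp [abs_of_pos hpi]
  rw [e] at hn
  calc ‖mlE ρ μ z‖ ≤ K / (1 + ‖z‖) * |D| / (2 * Real.pi) := by
        rw [le_div_iff₀ (by positivity), mul_comm]
        exact hn.trans (mul_le_mul_of_nonneg_left (le_abs_self D) (by positivity))
    _ = K * |D| / (2 * Real.pi) / (1 + ‖z‖) := by ring
    _ ≤ _ := by
        gcongr
        linarith
end

section
/- Let 0<ρ<1, μ∈ℂ, and α>0. Then there exists a constant M>0 such that for every real λ>0, every t≥0, and each choice of sign ∓, one has |E_{ρ,μ}(−(α∓√(α²−λ)) t^ρ)| ≤ M/(1+|α∓√(α²−λ)| t^ρ); in particular |E_{ρ,μ}(−(α∓√(α²−λ)) t^ρ)| ≤ M. -/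
/-- The principal complex square root of `α² - λ`. -/
noncomputable def sqrtD (α lam : ℝ) : ℂ := ((α ^ 2 - lam : ℝ) : ℂ) ^ ((1:ℂ)/2)

open Complex MeasureTheory Set Filter Topology

theorem continuousOn_cpow_mul_exp (μ r : ℂ) :
    ContinuousOn (fun t : ℝ ↦ (t : ℂ) ^ (μ - 1) * exp (-(r * t))) (Ioi 0) := by
  refine ContinuousOn.mul (fun t ht ↦ ?_) (by fun_prop)
  exact (continuousAt_ofReal_cpow_const t _ (Or.inr (ne_of_gt ht))).continuousWithinAt

theorem norm_cpow_mul_exp {t : ℝ} (ht : 0 < t) (μ r : ℂ) :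
    ‖(t : ℂ) ^ (μ - 1) * exp (-(r * t))‖ = t ^ (μ.re - 1) * Real.exp (-(r.re * t)) := by
  rw [norm_mul, norm_cpow_eq_rpow_re_of_pos ht, norm_exp]
  simp

theorem integrableOn_rpow_mul_exp {s c : ℝ} (hs : -1 < s) (hc : 0 < c) :
    IntegrableOn (fun t : ℝ ↦ t ^ s * Real.exp (-(c * t))) (Ioi 0) := by
  simpa using integrableOn_rpow_mul_exp_neg_mul_rpow hs one_pos hc

theorem integrableOn_cpow_mul_exp {μ r : ℂ} (hμ : 0 < μ.re) (hr : 0 < r.re) :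
    IntegrableOn (fun t : ℝ ↦ (t : ℂ) ^ (μ - 1) * exp (-(r * t))) (Ioi 0) := by
  refine Integrable.mono' (integrableOn_rpow_mul_exp (s := μ.re - 1) (by linarith) hr)
    ((continuousOn_cpow_mul_exp μ r).aestronglyMeasurable measurableSet_Ioi) ?_
  filter_upwards [ae_restrict_mem measurableSet_Ioi] with t ht
  exact (norm_cpow_mul_exp ht μ r).le

/-- The Laplace transform of a complex power, at a complex argument. -/
theorem laplace_cpow {μ r : ℂ} (hμ : 0 < μ.re) (hr : 0 < r.re) :
    ∫ t in Ioi (0 : ℝ), (t : ℂ) ^ (μ - 1) * exp (-(r * t)) = r ^ (-μ) * Gamma μ := by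
  have hopen : IsOpen {r : ℂ | 0 < r.re} := isOpen_lt continuous_const continuous_re
  have hF : AnalyticOnNhd ℂ
      (fun r : ℂ ↦ ∫ t in Ioi (0 : ℝ), (t : ℂ) ^ (μ - 1) * exp (-(r * t))) {r | 0 < r.re} := by
    refine DifferentiableOn.analyticOnNhd (fun z hz ↦ ?_) hopen
    have hz : 0 < z.re := hz
    have hs : {w : ℂ | z.re / 2 < w.re} ∈ 𝓝 z :=
      (isOpen_lt continuous_const continuous_re).mem_nhds (half_lt_self hz)
    refine (hasDerivAt_integral_of_dominated_loc_of_deriv_le hs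
      (F' := fun w t ↦ (t : ℂ) ^ (μ - 1) * (exp (-(w * t)) * -(t : ℂ)))
      (bound := fun t ↦ t ^ μ.re * Real.exp (-(z.re / 2 * t)))
      (.of_forall fun w ↦
        (continuousOn_cpow_mul_exp μ w).aestronglyMeasurable measurableSet_Ioi)
      (integrableOn_cpow_mul_exp hμ hz) ?_ ?_
      (integrableOn_rpow_mul_exp (by linarith) (half_pos hz))
      ?_).2.differentiableAt.differentiableWithinAt
    · refine ContinuousOn.aestronglyMeasurable ?_ measurableSet_Ioi
      have := (continuousOn_cpow_mul_exp μ z).mul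
        (g := fun t : ℝ ↦ -(t : ℂ)) (by fun_prop)
      exact this.congr fun t _ ↦ by simp only [Pi.mul_apply]; ring
    · filter_upwards [ae_restrict_mem measurableSet_Ioi] with t ht w hw
      have ht : 0 < t := ht
      have hw : z.re / 2 < w.re := hw
      rw [← mul_assoc, norm_mul, norm_cpow_mul_exp ht, norm_neg, norm_real,
        Real.norm_of_nonneg ht.le]
      calc t ^ (μ.re - 1) * Real.exp (-(w.re * t)) * t
          = t ^ (μ.re - 1) * t * Real.exp (-(w.re * t)) := by ring
        _ = t ^ μ.re * Real.exp (-(w.re * t)) := by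
            rw [← Real.rpow_add_one ht.ne', sub_add_cancel]
        _ ≤ _ := by gcongr
    · filter_upwards with t w _
      refine HasDerivAt.const_mul _ ?_
      have : HasDerivAt (fun w : ℂ ↦ -(w * t)) (-(t : ℂ)) w := by
        simpa using (hasDerivAt_id w).mul_const (t : ℂ) |>.fun_neg
      exact this.cexp
  have hG : AnalyticOnNhd ℂ (fun r : ℂ ↦ r ^ (-μ) * Gamma μ) {r | 0 < r.re} := by
    refine DifferentiableOn.analyticOnNhd (fun z hz ↦ ?_) hopen
    exact ((differentiableAt_id.cpow_const (Or.inl hz)).mul_const _).differentiableWithinAt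
  refine hF.eqOn_of_preconnected_of_frequently_eq hG
    (convex_halfSpace_re_gt 0).isPreconnected (z₀ := 1) (by simp) ?_ hr
  have hreal : ∃ᶠ x : ℝ in 𝓝[≠] 1,
      ∫ t in Ioi (0 : ℝ), (t : ℂ) ^ (μ - 1) * exp (-((x : ℂ) * t)) = (x : ℂ) ^ (-μ) * Gamma μ := by
    refine Eventually.frequently ?_
    filter_upwards [mem_nhdsWithin_of_mem_nhds (Ioi_mem_nhds (one_pos : (0 : ℝ) < 1))] with x hx
    have hx : 0 < x := hx
    rw [integral_cpow_mul_exp_neg_mul_Ioi hμ hx, one_div, inv_cpow, cpow_neg]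
    rw [arg_ofReal_of_nonneg hx.le]
    exact Real.pi_pos.ne
  have htend : Tendsto (fun x : ℝ ↦ (x : ℂ)) (𝓝[≠] 1) (𝓝[≠] 1) := by
    refine tendsto_nhdsWithin_iff.2 ⟨?_, ?_⟩
    · exact (continuous_ofReal.tendsto' 1 1 (by simp)).mono_left nhdsWithin_le_nhds
    · filter_upwards [self_mem_nhdsWithin] with x hx
      simpa using hx
  exact htend.frequently hreal

theorem vertical_re (c ξ : ℝ) : ((c : ℂ) + (2 * Real.pi * ξ : ℝ) * I).re = c := by simp

/-- On a vertical line `Re s = c ≥ 1`, the power `s ^ (-ν)` decays quadratically. -/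
theorem norm_cpow_neg_vertical_le {c : ℝ} (hc : 1 ≤ c) {ν : ℂ} (hν : 2 ≤ ν.re) (ξ : ℝ) :
    ‖((c : ℂ) + (2 * Real.pi * ξ : ℝ) * I) ^ (-ν)‖ ≤
      Real.exp (Real.pi * |ν.im|) * c ^ (2 - ν.re) * (1 + ξ ^ 2)⁻¹ := by
  set s : ℂ := (c : ℂ) + (2 * Real.pi * ξ : ℝ) * I with hs
  have hre : s.re = c := by simp [hs]
  have him : s.im = 2 * Real.pi * ξ := by simp [hs]
  have hcs : c ≤ ‖s‖ := hre ▸ re_le_norm s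
  have hs0 : 0 < ‖s‖ := by linarith
  have hsq : 1 + ξ ^ 2 ≤ ‖s‖ ^ 2 := by
    rw [Complex.sq_norm, normSq_apply, hre, him]
    have := Real.pi_gt_three
    nlinarith [sq_nonneg ξ, mul_nonneg (sq_nonneg ξ) (show 0 ≤ Real.pi ^ 2 - 9 by nlinarith)]
  refine (norm_cpow_le _ _).trans ?_
  rw [div_eq_mul_inv, ← Real.exp_neg]
  have h1 : Real.exp (-(s.arg * (-ν).im)) ≤ Real.exp (Real.pi * |ν.im|) := by
    apply Real.exp_le_exp.2
    refine (le_abs_self _).trans ?_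
    rw [abs_neg, abs_mul, neg_im, abs_neg]
    gcongr
    exact abs_arg_le_pi s
  have h2 : ‖s‖ ^ (-ν).re ≤ c ^ (2 - ν.re) * (1 + ξ ^ 2)⁻¹ := by
    have : ‖s‖ ^ (-ν).re = ‖s‖ ^ (2 - ν.re) * (‖s‖ ^ 2)⁻¹ := by
      rw [← Real.rpow_natCast, ← Real.rpow_neg hs0.le, ← Real.rpow_add hs0]
      congr 1
      push_cast [neg_re]
      ring
    rw [this]
    gcongr ?_ * ?_
    · exact Real.rpow_le_rpow_of_nonpos (by linarith) hcs (by linarith)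
    · gcongr
  calc _ ≤ (c ^ (2 - ν.re) * (1 + ξ ^ 2)⁻¹) * Real.exp (Real.pi * |ν.im|) := by gcongr
    _ = _ := by ring

theorem continuous_cpow_vertical {c : ℝ} (hc : 0 < c) (ν : ℂ) :
    Continuous fun ξ : ℝ ↦ ((c : ℂ) + (2 * Real.pi * ξ : ℝ) * I) ^ ν :=
  Continuous.cpow (by fun_prop) continuous_const fun ξ ↦ Or.inl (by rwa [vertical_re])

theorem integrable_cpow_neg_vertical {c : ℝ} (hc : 1 ≤ c) {ν : ℂ} (hν : 2 ≤ ν.re) :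
    Integrable fun ξ : ℝ ↦ ((c : ℂ) + (2 * Real.pi * ξ : ℝ) * I) ^ (-ν) :=
  Integrable.mono' (integrable_inv_one_add_sq.const_mul _)
    (continuous_cpow_vertical (by linarith) _).aestronglyMeasurable
    (.of_forall (norm_cpow_neg_vertical_le hc hν))

open FourierTransform in
/-- The inverse Laplace (Bromwich) representation of the reciprocal Gamma function. -/
theorem inv_Gamma_eq_integral {c : ℝ} (hc : 1 ≤ c) {ν : ℂ} (hν : 2 ≤ ν.re) :
    (Gamma ν)⁻¹ = ∫ ξ : ℝ, exp ((c : ℂ) + (2 * Real.pi * ξ : ℝ) * I) *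
      ((c : ℂ) + (2 * Real.pi * ξ : ℝ) * I) ^ (-ν) := by
  have hc0 : 0 < c := by linarith
  have hν0 : 0 < ν.re := by linarith
  set f : ℝ → ℂ := (Ioi (0 : ℝ)).indicator fun t ↦ (t : ℂ) ^ (ν - 1) * exp (-((c : ℂ) * t))
  have hf : Integrable f :=
    (integrable_indicator_iff measurableSet_Ioi).2 (integrableOn_cpow_mul_exp hν0 (by simpa))
  have hFf : 𝓕 f = fun ξ : ℝ ↦ ((c : ℂ) + (2 * Real.pi * ξ : ℝ) * I) ^ (-ν) * Gamma ν := by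
    ext ξ
    rw [Real.fourier_real_eq_integral_exp_smul, ← laplace_cpow hν0 (by rwa [vertical_re]),
      ← integral_indicator measurableSet_Ioi]
    congr 1 with t
    by_cases ht : t ∈ Ioi (0 : ℝ)
    · simp only [f, indicator_of_mem ht, smul_eq_mul]
      rw [mul_left_comm, ← exp_add]
      congr 2
      push_cast
      ring
    · simp [f, indicator_of_notMem ht]
  have hFi : Integrable (𝓕 f) := by
    rw [hFf]
    exact (integrable_cpow_neg_vertical hc hν).mul_const _
  have hcont : ContinuousAt f 1 := by
    have h := ((continuousOn_cpow_mul_exp ν c).continuousAt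
      (Ioi_mem_nhds (one_pos : (0 : ℝ) < 1)))
    refine h.congr ?_
    filter_upwards [Ioi_mem_nhds (one_pos : (0 : ℝ) < 1)] with t ht
    simp only [f, indicator_of_mem ht]
  have hinv := hf.fourierInv_fourier_eq hFi hcont
  rw [Real.fourierInv_eq', hFf] at hinv
  have hf1 : f 1 = exp (-(c : ℂ)) := by
    simp [f]
  have hG : Gamma ν ≠ 0 := Gamma_ne_zero_of_re_pos hν0
  have h_integrand : ∀ ξ : ℝ, exp ((c : ℂ) + (2 * Real.pi * ξ : ℝ) * I) *
      ((c : ℂ) + (2 * Real.pi * ξ : ℝ) * I) ^ (-ν) = exp c * (Gamma ν)⁻¹ *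
        (exp ((2 * Real.pi * inner ℝ ξ (1 : ℝ) : ℝ) * I) •
          (((c : ℂ) + (2 * Real.pi * ξ : ℝ) * I) ^ (-ν) * Gamma ν)) := by
    intro ξ
    rw [exp_add, smul_eq_mul, show inner ℝ ξ (1 : ℝ) = ξ by simp]
    field_simp
  simp_rw [h_integrand]
  rw [integral_const_mul, hinv, hf1, exp_neg]
  field_simp [exp_ne_zero]

theorem norm_inv_Gamma_le {c : ℝ} (hc : 1 ≤ c) {ν : ℂ} (hν : 2 ≤ ν.re) :
    ‖(Gamma ν)⁻¹‖ ≤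
      Real.exp c * (Real.exp (Real.pi * |ν.im|) * c ^ (2 - ν.re) * Real.pi) := by
  have hb : Integrable fun ξ : ℝ ↦
      Real.exp c * (Real.exp (Real.pi * |ν.im|) * c ^ (2 - ν.re) * (1 + ξ ^ 2)⁻¹) :=
    (integrable_inv_one_add_sq.const_mul _).const_mul _
  rw [inv_Gamma_eq_integral hc hν]
  refine (norm_integral_le_of_norm_le hb (.of_forall fun ξ ↦ ?_)).trans_eq ?_
  · rw [norm_mul, norm_exp, vertical_re]
    gcongr
    exact norm_cpow_neg_vertical_le hc hν ξ
  · rw [integral_const_mul, integral_const_mul, integral_univ_inv_one_add_sq]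

theorem summable_pow_mul_norm_inv_Gamma {ρ : ℝ} (hρ : 0 < ρ) (μ : ℂ) {R : ℝ} (hR : 0 ≤ R) :
    Summable fun k : ℕ ↦ R ^ k * ‖(Gamma (((ρ * k : ℝ) : ℂ) + μ))⁻¹‖ := by
  obtain ⟨c, hc, hRc⟩ : ∃ c : ℝ, 1 ≤ c ∧ R < c ^ ρ :=
    ((eventually_ge_atTop 1).and ((tendsto_rpow_atTop hρ).eventually_gt_atTop R)).exists
  have hc0 : 0 < c := by linarith
  have hcρ : 0 < c ^ ρ := Real.rpow_pos_of_pos hc0 ρ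
  refine summable_of_isBigO_nat (g := fun k : ℕ ↦ (R / c ^ ρ) ^ k)
    (summable_geometric_of_lt_one (by positivity) ((div_lt_one hcρ).2 hRc))
    (.of_bound (Real.exp c * (Real.exp (Real.pi * |μ.im|) * c ^ (2 - μ.re) * Real.pi)) ?_)
  have hlarge : ∀ᶠ k : ℕ in atTop, 2 - μ.re ≤ ρ * k :=
    (tendsto_natCast_atTop_atTop.const_mul_atTop hρ).eventually_ge_atTop _
  filter_upwards [hlarge] with k hk
  have hre : (((ρ * k : ℝ) : ℂ) + μ).re = ρ * k + μ.re := by rw [add_re, ofReal_re]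
  have him : (((ρ * k : ℝ) : ℂ) + μ).im = μ.im := by rw [add_im, ofReal_im, zero_add]
  have hb := norm_inv_Gamma_le hc (ν := ((ρ * k : ℝ) : ℂ) + μ) (by rw [hre]; linarith)
  rw [hre, him] at hb
  have hpow : c ^ (2 - (ρ * k + μ.re)) = c ^ (2 - μ.re) * ((c ^ ρ) ^ k)⁻¹ := by
    rw [← Real.rpow_mul_natCast hc0.le, ← Real.rpow_neg hc0.le, ← Real.rpow_add hc0]
    congr 1
    ring
  rw [hpow] at hb
  rw [Real.norm_of_nonneg (by positivity), Real.norm_of_nonneg (by positivity)]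
  refine (mul_le_mul_of_nonneg_left hb (by positivity)).trans_eq ?_
  rw [div_pow]
  ring

theorem norm_mlE_term_le (ρ : ℝ) (μ : ℂ) {z : ℂ} {R : ℝ} (hz : ‖z‖ ≤ R) (k : ℕ) :
    ‖z ^ k / Gamma (((ρ * k : ℝ) : ℂ) + μ)‖ ≤ R ^ k * ‖(Gamma (((ρ * k : ℝ) : ℂ) + μ))⁻¹‖ := by
  rw [div_eq_mul_inv, norm_mul, norm_pow]
  gcongr

theorem hasSum_mlE {ρ : ℝ} (hρ : 0 < ρ) (μ z : ℂ) :
    HasSum (fun k : ℕ ↦ z ^ k / Gamma (((ρ * k : ℝ) : ℂ) + μ)) (mlE ρ μ z) :=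
  (Summable.of_norm_bounded (summable_pow_mul_norm_inv_Gamma hρ μ (norm_nonneg z))
    (norm_mlE_term_le ρ μ le_rfl)).hasSum

theorem differentiable_mlE {ρ : ℝ} (hρ : 0 < ρ) (μ : ℂ) : Differentiable ℂ (mlE ρ μ) := by
  intro z
  have h := differentiableOn_tsum_of_summable_norm
    (F := fun (k : ℕ) (z : ℂ) ↦ z ^ k / Gamma (((ρ * k : ℝ) : ℂ) + μ))
    (summable_pow_mul_norm_inv_Gamma hρ μ (R := ‖z‖ + 1) (by positivity))
    (fun k ↦ by fun_prop) (Metric.isOpen_ball (x := (0 : ℂ)) (ε := ‖z‖ + 1))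
    (fun k w hw ↦ norm_mlE_term_le ρ μ (mem_ball_zero_iff.1 hw).le k)
  exact h.differentiableAt (Metric.isOpen_ball.mem_nhds (by simp))

theorem mlE_eq_deriv {ρ : ℝ} (hρ : 0 < ρ) (μ z : ℂ) :
    mlE ρ μ z = μ * mlE ρ (μ + 1) z + ρ * (z * deriv (mlE ρ (μ + 1)) z) := by
  have h := hasSum_deriv_of_summable_norm (z := z)
    (F := fun (k : ℕ) (z : ℂ) ↦ z ^ k / Gamma (((ρ * k : ℝ) : ℂ) + (μ + 1)))
    (summable_pow_mul_norm_inv_Gamma hρ (μ + 1) (R := ‖z‖ + 1) (by positivity))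
    (fun k ↦ by fun_prop) (Metric.isOpen_ball (x := (0 : ℂ)) (ε := ‖z‖ + 1))
    (fun k w hw ↦ norm_mlE_term_le ρ (μ + 1) (mem_ball_zero_iff.1 hw).le k) (by simp)
  have hsum := ((hasSum_mlE hρ (μ + 1) z).mul_left μ).add ((h.mul_left z).mul_left (ρ : ℂ))
  refine (hasSum_mlE hρ μ z).unique (hsum.congr_fun ?_)
  intro k
  have hd : z * deriv (fun z : ℂ ↦ z ^ k / Gamma (((ρ * k : ℝ) : ℂ) + (μ + 1))) z =
      k * z ^ k / Gamma (((ρ * k : ℝ) : ℂ) + (μ + 1)) := by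
    rw [deriv_div_const, deriv_pow_field]
    rcases k with _ | k
    · simp
    · simp only [add_tsub_cancel_right]
      ring
  rw [hd, div_eq_mul_inv, one_div_Gamma_eq_self_mul_one_div_Gamma_add_one, add_assoc]
  push_cast
  ring

/-- For `0 < ρ < 1`, the power `s ^ ρ` maps the right half-plane into a proper cone. -/
theorem cos_mul_norm_le_re_cpow {ρ : ℝ} (hρ0 : 0 < ρ) (hρ1 : ρ < 1) {s : ℂ} (hs : 0 < s.re) :
    Real.cos (ρ * (Real.pi / 2)) * ‖s ^ (ρ : ℂ)‖ ≤ (s ^ (ρ : ℂ)).re := by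
  rw [cpow_ofReal_re, norm_cpow_real, mul_comm]
  gcongr
  rw [← Real.cos_abs (s.arg * ρ)]
  have harg : |s.arg| ≤ Real.pi / 2 := abs_arg_le_pi_div_two_iff.2 hs.le
  apply Real.cos_le_cos_of_nonneg_of_le_pi (abs_nonneg _)
  · nlinarith [Real.pi_pos]
  · rw [abs_mul, abs_of_pos hρ0, mul_comm]
    gcongr

/-- Cones that meet only at the origin are separated. -/
theorem norm_sub_lower_bound {a b : ℝ} (ha : 0 < a) (hab : a < b) (hb : b ≤ 1) {w z : ℂ}
    (hw : b * ‖w‖ ≤ w.re) (hz : z.re ≤ a * ‖z‖) :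
    (b - a) / 4 * (‖w‖ + ‖z‖) ≤ ‖w - z‖ := by
  have h1 : w.re - z.re ≤ ‖w - z‖ := by simpa using re_le_norm (w - z)
  have h2 : ‖z‖ ≤ ‖w‖ + ‖w - z‖ := by
    have := norm_sub_le w (w - z)
    rwa [sub_sub_cancel] at this
  have h3 : ‖w‖ ≤ ‖z‖ + ‖w - z‖ := by
    have := norm_add_le z (w - z)
    rwa [add_sub_cancel] at this
  have h4 := norm_nonneg (w - z)
  have hA : (b - a) * ‖w‖ ≤ 2 * ‖w - z‖ := by nlinarith
  have hB : (b - a) * ‖z‖ ≤ 2 * ‖w - z‖ := by nlinarith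
  linarith

/-- The Bromwich representation of the Mittag-Leffler function on the unit disc. -/
theorem mlE_eq_integral_of_norm_lt_one {ρ : ℝ} (hρ0 : 0 < ρ) {μ : ℂ} (hμ : 2 ≤ μ.re) {z : ℂ}
    (hz : ‖z‖ < 1) :
    mlE ρ μ z = ∫ ξ : ℝ, exp (((1 : ℝ) : ℂ) + (2 * Real.pi * ξ : ℝ) * I) *
      (((1 : ℝ) : ℂ) + (2 * Real.pi * ξ : ℝ) * I) ^ (-(μ - ρ)) *
        ((((1 : ℝ) : ℂ) + (2 * Real.pi * ξ : ℝ) * I) ^ (ρ : ℂ) - z)⁻¹ := by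
  set s : ℝ → ℂ := fun ξ ↦ ((1 : ℝ) : ℂ) + (2 * Real.pi * ξ : ℝ) * I
  have hsre : ∀ ξ, (s ξ).re = 1 := fun ξ ↦ vertical_re 1 ξ
  have hs0 : ∀ ξ, s ξ ≠ 0 := fun ξ h ↦ by simpa [h] using hsre ξ
  set F : ℕ → ℝ → ℂ := fun k ξ ↦ z ^ k * (exp (s ξ) * s ξ ^ (-(((ρ * k : ℝ) : ℂ) + μ)))
  have hre : ∀ k : ℕ, 2 ≤ (((ρ * k : ℝ) : ℂ) + μ).re := fun k ↦ by
    rw [add_re, ofReal_re]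
    have : 0 ≤ ρ * k := by positivity
    linarith
  have hbound : ∀ k ξ, ‖F k ξ‖ ≤
      ‖z‖ ^ k * (Real.exp 1 * (Real.exp (Real.pi * |μ.im|) * (1 + ξ ^ 2)⁻¹)) := fun k ξ ↦ by
    have h := norm_cpow_neg_vertical_le le_rfl (hre k) ξ
    rw [Real.one_rpow, mul_one, add_im, ofReal_im, zero_add] at h
    rw [norm_mul, norm_mul, norm_pow, norm_exp, hsre]
    gcongr
  have hbi : ∀ k : ℕ, Integrable fun ξ : ℝ ↦
      ‖z‖ ^ k * (Real.exp 1 * (Real.exp (Real.pi * |μ.im|) * (1 + ξ ^ 2)⁻¹)) := fun k ↦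
    ((integrable_inv_one_add_sq.const_mul _).const_mul _).const_mul _
  have hFi : ∀ k, Integrable (F k) := fun k ↦ by
    refine (hbi k).mono' (Continuous.aestronglyMeasurable ?_) (.of_forall (hbound k))
    have := continuous_cpow_vertical one_pos (-(((ρ * k : ℝ) : ℂ) + μ))
    exact continuous_const.mul (Continuous.mul (by fun_prop) this)
  have hsum : Summable fun k ↦ ∫ ξ, ‖F k ξ‖ := by
    refine Summable.of_nonneg_of_le (fun k ↦ integral_nonneg fun ξ ↦ norm_nonneg _)
      (fun k ↦ integral_mono (hFi k).norm (hbi k) (hbound k)) ?_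
    simp_rw [integral_const_mul]
    exact (summable_geometric_of_lt_one (norm_nonneg z) hz).mul_right _
  have hmain := hasSum_integral_of_summable_integral_norm hFi hsum
  have hterm : ∀ k : ℕ, ∫ ξ, F k ξ = z ^ k / Gamma (((ρ * k : ℝ) : ℂ) + μ) := fun k ↦ by
    simp only [F]
    rw [integral_const_mul, ← inv_Gamma_eq_integral le_rfl (hre k), div_eq_mul_inv]
  simp_rw [hterm] at hmain
  rw [(hasSum_mlE hρ0 μ z).unique hmain]
  congr 1 with ξ
  have hw : 1 ≤ ‖s ξ ^ (ρ : ℂ)‖ := by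
    rw [norm_cpow_real]
    exact Real.one_le_rpow ((hsre ξ).symm.le.trans (re_le_norm _)) hρ0.le
  have hw0 : s ξ ^ (ρ : ℂ) ≠ 0 := norm_pos_iff.1 (by linarith)
  have hgeom : HasSum (fun k : ℕ ↦ (z / s ξ ^ (ρ : ℂ)) ^ k) (1 - z / s ξ ^ (ρ : ℂ))⁻¹ := by
    refine hasSum_geometric_of_norm_lt_one ?_
    rw [norm_div, div_lt_one (by linarith)]
    linarith
  have hval : exp (s ξ) * s ξ ^ (-μ) * (1 - z / s ξ ^ (ρ : ℂ))⁻¹ =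
      exp (s ξ) * s ξ ^ (-(μ - ρ)) * (s ξ ^ (ρ : ℂ) - z)⁻¹ := by
    rw [show -(μ - (ρ : ℂ)) = -μ + ρ by ring, cpow_add _ _ (hs0 ξ), one_sub_div hw0, inv_div]
    ring
  rw [← hval]
  refine HasSum.tsum_eq ((hgeom.mul_left (exp (s ξ) * s ξ ^ (-μ))).congr_fun fun k ↦ ?_)
  simp only [F]
  rw [neg_add, cpow_add _ _ (hs0 ξ), cpow_neg (s ξ) ((ρ * k : ℝ) : ℂ)]
  have : s ξ ^ ((ρ * k : ℝ) : ℂ) = (s ξ ^ (ρ : ℂ)) ^ k := by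
    push_cast
    rw [cpow_mul_nat]
  rw [this, div_pow]
  ring

theorem differentiableOn_bromwich {ρ b : ℝ} {μ : ℂ} (hμ : 2 ≤ (μ - ρ).re)
    (hcone : ∀ s : ℂ, s.re = 1 → b * ‖s ^ (ρ : ℂ)‖ ≤ (s ^ (ρ : ℂ)).re ∧ 1 ≤ ‖s ^ (ρ : ℂ)‖)
    (hopen : IsOpen {z : ℂ | z.re < b * ‖z‖ ∨ ‖z‖ < 1}) :
    DifferentiableOn ℂ (fun z ↦ ∫ ξ : ℝ, exp (((1 : ℝ) : ℂ) + (2 * Real.pi * ξ : ℝ) * I) *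
      (((1 : ℝ) : ℂ) + (2 * Real.pi * ξ : ℝ) * I) ^ (-(μ - ρ)) *
        ((((1 : ℝ) : ℂ) + (2 * Real.pi * ξ : ℝ) * I) ^ (ρ : ℂ) - z)⁻¹)
      {z : ℂ | z.re < b * ‖z‖ ∨ ‖z‖ < 1} := by
  intro z hz
  obtain ⟨ε, hε, hball⟩ := Metric.isOpen_iff.1 hopen z hz
  set s : ℝ → ℂ := fun ξ ↦ ((1 : ℝ) : ℂ) + (2 * Real.pi * ξ : ℝ) * I
  have hsre : ∀ ξ, (s ξ).re = 1 := fun ξ ↦ vertical_re 1 ξ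
  have hsep : ∀ w ∈ Metric.ball z (ε / 2), ∀ ξ, ε / 2 ≤ ‖s ξ ^ (ρ : ℂ) - w‖ := by
    intro w hw ξ
    by_contra! h
    have hmem : s ξ ^ (ρ : ℂ) ∈ Metric.ball z ε := by
      rw [Metric.mem_ball]
      rw [Metric.mem_ball] at hw
      have := dist_triangle (s ξ ^ (ρ : ℂ)) w z
      rw [dist_eq_norm (s ξ ^ (ρ : ℂ)) w] at this
      linarith
    obtain ⟨h1, h2⟩ := hcone (s ξ) (hsre ξ)
    rcases hball hmem with h3 | h3 <;> linarith
  have hcont : Continuous fun ξ ↦ exp (s ξ) * s ξ ^ (-(μ - ρ)) :=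
    Continuous.mul (by fun_prop) (continuous_cpow_vertical one_pos _)
  have hcont' : ∀ w ∈ Metric.ball z (ε / 2), Continuous fun ξ ↦ (s ξ ^ (ρ : ℂ) - w)⁻¹ := by
    intro w hw
    refine ((continuous_cpow_vertical one_pos _).sub continuous_const).inv₀ fun ξ ↦ ?_
    exact norm_pos_iff.1 ((half_pos hε).trans_le (hsep w hw ξ))
  have h_integrand : Integrable fun ξ ↦ exp (s ξ) * s ξ ^ (-(μ - ρ)) := by
    refine (integrable_cpow_neg_vertical le_rfl hμ).bdd_mul (c := Real.exp 1)
      (Continuous.aestronglyMeasurable (by fun_prop)) (.of_forall fun ξ ↦ ?_)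
    rw [norm_exp, vertical_re]
  have hz' : z ∈ Metric.ball z (ε / 2) := Metric.mem_ball_self (half_pos hε)
  have hinv : ∀ w ∈ Metric.ball z (ε / 2), ∀ ξ, ‖(s ξ ^ (ρ : ℂ) - w)⁻¹‖ ≤ (ε / 2)⁻¹ := by
    intro w hw ξ
    rw [norm_inv]
    exact inv_anti₀ (half_pos hε) (hsep w hw ξ)
  refine (hasDerivAt_integral_of_dominated_loc_of_deriv_le
    (Metric.ball_mem_nhds z (half_pos hε))
    (F' := fun w ξ ↦ exp (s ξ) * s ξ ^ (-(μ - ρ)) * ((s ξ ^ (ρ : ℂ) - w)⁻¹) ^ 2)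
    (bound := fun ξ ↦ ‖exp (s ξ) * s ξ ^ (-(μ - ρ))‖ * ((ε / 2)⁻¹) ^ 2) ?_ ?_ ?_ ?_
    (h_integrand.norm.mul_const _) ?_).2.differentiableAt.differentiableWithinAt
  · filter_upwards [Metric.ball_mem_nhds z (half_pos hε)] with w hw
    exact (hcont.mul (hcont' w hw)).aestronglyMeasurable
  · exact h_integrand.mul_bdd (c := (ε / 2)⁻¹) (hcont' z hz').aestronglyMeasurable
      (.of_forall (hinv z hz'))
  · exact (hcont.mul ((hcont' z hz').pow 2)).aestronglyMeasurable
  · refine .of_forall fun ξ w hw ↦ ?_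
    rw [norm_mul, norm_pow]
    gcongr
    exact hinv w hw ξ
  · refine .of_forall fun ξ w hw ↦ HasDerivAt.const_mul _ ?_
    have hne : s ξ ^ (ρ : ℂ) - w ≠ 0 :=
      norm_pos_iff.1 ((half_pos hε).trans_le (hsep w hw ξ))
    have h := ((hasDerivAt_id w).const_sub (s ξ ^ (ρ : ℂ))).fun_inv hne
    exact h.congr_deriv (by simp)

theorem mlE_eq_integral {ρ b : ℝ} (hρ0 : 0 < ρ) {μ : ℂ} (hμ : 2 ≤ (μ - ρ).re)
    (hcone : ∀ s : ℂ, s.re = 1 → b * ‖s ^ (ρ : ℂ)‖ ≤ (s ^ (ρ : ℂ)).re ∧ 1 ≤ ‖s ^ (ρ : ℂ)‖)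
    {z : ℂ} (hz : z.re < b * ‖z‖ ∨ ‖z‖ < 1) :
    mlE ρ μ z = ∫ ξ : ℝ, exp (((1 : ℝ) : ℂ) + (2 * Real.pi * ξ : ℝ) * I) *
      (((1 : ℝ) : ℂ) + (2 * Real.pi * ξ : ℝ) * I) ^ (-(μ - ρ)) *
        ((((1 : ℝ) : ℂ) + (2 * Real.pi * ξ : ℝ) * I) ^ (ρ : ℂ) - z)⁻¹ := by
  have hopen : IsOpen {z : ℂ | z.re < b * ‖z‖ ∨ ‖z‖ < 1} :=
    (isOpen_lt continuous_re (by fun_prop)).union (isOpen_lt continuous_norm continuous_const)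
  have h0 : (0 : ℂ) ∈ {z : ℂ | z.re < b * ‖z‖ ∨ ‖z‖ < 1} := Or.inr (by simp)
  have hstar : StarConvex ℝ (0 : ℂ) {z : ℂ | z.re < b * ‖z‖ ∨ ‖z‖ < 1} := by
    rw [starConvex_zero_iff]
    rintro w hw t ht0 ht1
    rcases ht0.eq_or_lt with rfl | ht
    · simp
    · have hn : ‖t • w‖ = t * ‖w‖ := by rw [norm_smul, Real.norm_of_nonneg ht0]
      have hr : (t • w).re = t * w.re := by simp
      rcases hw with hw | hw
      · refine Or.inl ?_
        rw [hn, hr]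
        nlinarith
      · refine Or.inr ?_
        rw [hn]
        nlinarith [norm_nonneg w]
  refine AnalyticOnNhd.eqOn_of_preconnected_of_eventuallyEq
    ((differentiable_mlE hρ0 μ).differentiableOn.analyticOnNhd hopen)
    ((differentiableOn_bromwich hμ hcone hopen).analyticOnNhd hopen)
    (hstar.isPathConnected h0).isConnected.isPreconnected h0 ?_ hz
  filter_upwards [Metric.ball_mem_nhds (0 : ℂ) one_pos] with w hw
  refine mlE_eq_integral_of_norm_lt_one hρ0 ?_ (mem_ball_zero_iff.1 hw)
  rw [sub_re, ofReal_re] at hμ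
  linarith

/-- A decay bound on a sector containing the closed left half-plane. -/
def MlSectorBound (ρ : ℝ) (μ : ℂ) : Prop :=
  ∃ a > (0 : ℝ), ∃ C > (0 : ℝ), ∀ z : ℂ, z.re ≤ a * ‖z‖ → ‖mlE ρ μ z‖ ≤ C / (1 + ‖z‖)

theorem mlSectorBound_of_three_le_re {ρ : ℝ} (hρ0 : 0 < ρ) (hρ1 : ρ < 1) {μ : ℂ}
    (hμ : 3 ≤ μ.re) : MlSectorBound ρ μ := by
  set b : ℝ := Real.cos (ρ * (Real.pi / 2))
  have hb0 : 0 < b := Real.cos_pos_of_mem_Ioo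
    ⟨by nlinarith [Real.pi_pos], by nlinarith [Real.pi_pos]⟩
  have hb1 : b ≤ 1 := Real.cos_le_one _
  have hμρ : 2 ≤ (μ - ρ).re := by
    rw [sub_re, ofReal_re]
    linarith
  have hcone : ∀ s : ℂ, s.re = 1 →
      b * ‖s ^ (ρ : ℂ)‖ ≤ (s ^ (ρ : ℂ)).re ∧ 1 ≤ ‖s ^ (ρ : ℂ)‖ := fun s hs ↦ by
    refine ⟨cos_mul_norm_le_re_cpow hρ0 hρ1 (by linarith), ?_⟩
    rw [norm_cpow_real]
    exact Real.one_le_rpow (hs.symm.le.trans (re_le_norm _)) hρ0.le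
  refine ⟨b / 2, half_pos hb0, (b / 8)⁻¹ *
    (Real.exp 1 * (Real.exp (Real.pi * |(μ - ρ).im|) * Real.pi)), by positivity, fun z hz ↦ ?_⟩
  have hz' : z.re < b * ‖z‖ ∨ ‖z‖ < 1 := by
    rcases (norm_nonneg z).eq_or_lt with h | h
    · exact Or.inr (by linarith)
    · exact Or.inl (by nlinarith)
  have hbi : Integrable fun ξ : ℝ ↦ (b / 8)⁻¹ / (1 + ‖z‖) *
      (Real.exp 1 * (Real.exp (Real.pi * |(μ - ρ).im|) * (1 + ξ ^ 2)⁻¹)) :=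
    ((integrable_inv_one_add_sq.const_mul _).const_mul _).const_mul _
  rw [mlE_eq_integral hρ0 hμρ hcone hz']
  refine (norm_integral_le_of_norm_le hbi (.of_forall fun ξ ↦ ?_)).trans_eq ?_
  · obtain ⟨h1, h2⟩ := hcone _ (vertical_re 1 ξ)
    have hsep := norm_sub_lower_bound (half_pos hb0) (half_lt_self hb0) hb1 h1 hz
    have hpow := norm_cpow_neg_vertical_le le_rfl hμρ ξ
    rw [Real.one_rpow, mul_one] at hpow
    rw [norm_mul, norm_mul, norm_exp, vertical_re, norm_inv, mul_comm]
    gcongr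
    rw [div_eq_mul_inv, ← mul_inv]
    refine inv_anti₀ (by positivity) (le_trans ?_ hsep)
    rw [show (b - b / 2) / 4 = b / 8 by ring]
    gcongr
  · rw [integral_const_mul, integral_const_mul, integral_const_mul, integral_univ_inv_one_add_sq]
    ring

theorem MlSectorBound.of_add_one {ρ : ℝ} (hρ : 0 < ρ) {μ : ℂ} (h : MlSectorBound ρ (μ + 1)) :
    MlSectorBound ρ μ := by
  obtain ⟨a, ha, C, hC, hbd⟩ := h
  set δ : ℝ := a / (2 * (1 + a))
  have hδ0 : 0 < δ := by positivity
  have hδa : δ * (2 * (1 + a)) = a := div_mul_cancel₀ _ (by positivity)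
  have hδ1 : δ < 1 := by nlinarith
  have hδ1' : 0 < 1 - δ := by linarith
  refine ⟨a / 2, half_pos ha, ‖μ‖ * C + ρ * (C / (δ * (1 - δ))), by positivity, fun z hz ↦ ?_⟩
  have hE : ‖mlE ρ (μ + 1) z‖ ≤ C / (1 + ‖z‖) := hbd z (by nlinarith [norm_nonneg z])
  have hD : ‖z‖ * ‖deriv (mlE ρ (μ + 1)) z‖ ≤ C / (δ * (1 - δ)) / (1 + ‖z‖) := by
    rcases (norm_nonneg z).eq_or_lt with h0 | h0
    · rw [← h0]
      simp only [zero_mul]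
      positivity
    have hcauchy := norm_deriv_le_of_forall_mem_sphere_norm_le (c := z) (mul_pos hδ0 h0)
      (differentiable_mlE hρ (μ + 1)).diffContOnCl
      (C := C / ((1 - δ) * (1 + ‖z‖))) (fun w hw ↦ ?_)
    · calc _ ≤ ‖z‖ * (C / ((1 - δ) * (1 + ‖z‖)) / (δ * ‖z‖)) := by gcongr
        _ = _ := by field_simp
    · rw [mem_sphere_iff_norm] at hw
      have h1 : ‖z‖ ≤ ‖w‖ + ‖w - z‖ := by
        have := norm_sub_le w (w - z)
        rwa [sub_sub_cancel] at this
      have h2 : w.re - z.re ≤ ‖w - z‖ := by simpa using re_le_norm (w - z)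
      have h3 : (1 - δ) * ‖z‖ ≤ ‖w‖ := by nlinarith
      refine (hbd w ?_).trans ?_
      · nlinarith
      · gcongr
        nlinarith
  rw [mlE_eq_deriv hρ]
  calc _ ≤ ‖μ‖ * ‖mlE ρ (μ + 1) z‖ + ρ * (‖z‖ * ‖deriv (mlE ρ (μ + 1)) z‖) := by
        refine (norm_add_le _ _).trans_eq ?_
        rw [norm_mul, norm_mul, norm_mul, norm_real, Real.norm_of_nonneg hρ.le]
    _ ≤ ‖μ‖ * (C / (1 + ‖z‖)) + ρ * (C / (δ * (1 - δ)) / (1 + ‖z‖)) := by gcongr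
    _ = _ := by ring

theorem mlSectorBound {ρ : ℝ} (hρ0 : 0 < ρ) (hρ1 : ρ < 1) (μ : ℂ) : MlSectorBound ρ μ := by
  obtain ⟨n, hn⟩ := exists_nat_ge (3 - μ.re)
  induction n generalizing μ with
  | zero =>
    refine mlSectorBound_of_three_le_re hρ0 hρ1 ?_
    push_cast at hn
    linarith
  | succ n ih =>
    refine (ih (μ + 1) ?_).of_add_one hρ0
    push_cast at hn
    rw [add_re, one_re]
    linarith

theorem abs_re_sqrtD_le {α lam : ℝ} (hα : 0 < α) (hlam : 0 < lam) : |(sqrtD α lam).re| ≤ α := by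
  have hsq : sqrtD α lam ^ 2 = ((α ^ 2 - lam : ℝ) : ℂ) := by
    rw [sqrtD, ← cpow_mul_nat]
    norm_num
  have hre := congrArg re hsq
  have him := congrArg im hsq
  simp only [sq, mul_re, mul_im, ofReal_re, ofReal_im] at hre him
  apply abs_le_of_sq_le_sq _ hα.le
  rcases mul_eq_zero.1 (show (sqrtD α lam).re * (sqrtD α lam).im = 0 by linarith) with h | h
  · rw [h]
    nlinarith
  · rw [h] at hre
    nlinarith

/-- Uniform Mittag-Leffler bounds along the spectral rays
`-(α ∓ √(α²-λ)) t^ρ`. -/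
theorem mittagLeffler_ray_bound
    (ρ : ℝ) (hρ0 : 0 < ρ) (hρ1 : ρ < 1) (μ : ℂ) (α : ℝ) (hα : 0 < α) :
    ∃ M > (0:ℝ), ∀ lam : ℝ, 0 < lam → ∀ t : ℝ, 0 ≤ t →
      ∀ σ : ℂ, (σ = 1 ∨ σ = -1) →
        ‖mlE ρ μ (-(((α : ℂ) + σ * sqrtD α lam)) * ((t ^ ρ : ℝ) : ℂ))‖ ≤
            M / (1 + ‖(α : ℂ) + σ * sqrtD α lam‖ * t ^ ρ) ∧
        ‖mlE ρ μ (-(((α : ℂ) + σ * sqrtD α lam)) * ((t ^ ρ : ℝ) : ℂ))‖ ≤ M := by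
  obtain ⟨a, ha, C, hC, hbd⟩ := mlSectorBound hρ0 hρ1 μ
  refine ⟨C, hC, fun lam hlam t ht σ hσ ↦ ?_⟩
  have htρ : 0 ≤ t ^ ρ := Real.rpow_nonneg ht ρ
  have hre : 0 ≤ ((α : ℂ) + σ * sqrtD α lam).re := by
    have h := abs_le.1 (abs_re_sqrtD_le hα hlam)
    rcases hσ with rfl | rfl <;> simp <;> linarith
  set w : ℂ := (α : ℂ) + σ * sqrtD α lam
  have hz : (-w * ((t ^ ρ : ℝ) : ℂ)).re ≤ a * ‖-w * ((t ^ ρ : ℝ) : ℂ)‖ := by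
    have h1 : (-w * ((t ^ ρ : ℝ) : ℂ)).re = -(w.re * t ^ ρ) := by
      rw [re_mul_ofReal, neg_re, neg_mul]
    rw [h1]
    exact (neg_nonpos.2 (mul_nonneg hre htρ)).trans (by positivity)
  have hmain := hbd _ hz
  rw [norm_mul, norm_neg, norm_real, Real.norm_of_nonneg htρ] at hmain
  exact ⟨hmain, hmain.trans (div_le_self hC.le (le_add_of_nonneg_right (by positivity)))⟩
end
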